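/- Let O ⊆ ℝ^d be an open set and let δ, ω be positive Borel measures on O with compact support in O such that ω is a har(O)-balayage of δ, i.e. ∫ h dδ = ∫ h dω for every h harmonic on O. Set S := supp ω ∪ supp δ and S_O := infill_O S. Then ∫ h dδ = ∫ h dω for every function h harmonic on an open neighborhood of S_O; in particular, for every open set O′ ⊆ ℝ^d with O′ ⊇ S_O, ω is a har(O′)-balayage of δ. -/

import Mathlib

open MeasureTheory Metric Set Filter
open scoped ENNReal Topology OnePoint

noncomputable section

/-- `d`-dimensional Euclidean space. -/
abbrev Euc (d : ℕ) : Type := EuclideanSpace ℝ (Fin d)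

/-- A real-valued function is *harmonic on a set* if it is continuous there and satisfies
the mean value equality over every closed ball contained in the set. -/
def HarmOn {d : ℕ} (h : Euc d → ℝ) (O : Set (Euc d)) : Prop :=
  ContinuousOn h O ∧
    ∀ x : Euc d, ∀ r : ℝ, 0 < r → closedBall x r ⊆ O →
      h x = ⨍ y in closedBall x r, h y ∂volume

/-- An `EReal`-valued function is *subharmonic on a set* if it is upper semicontinuous there,
nowhere `+∞` there, and on every closed ball contained in the set it is dominated by each
continuous function harmonic in the interior that dominates it on the boundary sphere. -/
def SbhOn {d : ℕ} (u : Euc d → EReal) (O : Set (Euc d)) : Prop :=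
  UpperSemicontinuousOn u O ∧ (∀ x ∈ O, u x < ⊤) ∧
    ∀ x : Euc d, ∀ r : ℝ, 0 < r → closedBall x r ⊆ O →
      ∀ h : Euc d → ℝ, ContinuousOn h (closedBall x r) → HarmOn h (ball x r) →
        (∀ y ∈ sphere x r, u y ≤ (h y : EReal)) →
        ∀ y ∈ closedBall x r, u y ≤ (h y : EReal)

/-- The positive part of an extended real number, as a member of `ℝ≥0∞`. -/
def erealPos (x : EReal) : ℝ≥0∞ := if x = ⊤ then ⊤ else ENNReal.ofReal x.toReal

/-- The integral of an `EReal`-valued function against a measure, with values in `EReal`: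
the lower integral of the positive part minus the lower integral of the negative part. -/
def eInt {d : ℕ} (μ : Measure (Euc d)) (u : Euc d → EReal) : EReal :=
  ((∫⁻ x, erealPos (u x) ∂μ : ℝ≥0∞) : EReal) -
    ((∫⁻ x, erealPos (-(u x)) ∂μ : ℝ≥0∞) : EReal)

/-- The (closed) support of a measure: points all of whose open neighbourhoods
have strictly positive measure. -/
def msupp {d : ℕ} (μ : Measure (Euc d)) : Set (Euc d) :=
  {x | ∀ U : Set (Euc d), IsOpen U → x ∈ U → 0 < μ U}

/-- A finite positive Borel measure whose support is a compact subset of `O`. -/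
def MeasCompIn {d : ℕ} (μ : Measure (Euc d)) (O : Set (Euc d)) : Prop :=
  IsCompact (msupp μ) ∧ msupp μ ⊆ O ∧ μ (msupp μ)ᶜ = 0 ∧ μ Set.univ < ⊤

/-- The *inward filling* of `S` with respect to `O`: the union of `S` with all connected
components of `O \ S` that are relatively compact in `O`. -/
def infill {X : Type*} [TopologicalSpace X] (O S : Set X) : Set X :=
  S ∪ {y | ∃ x ∈ O \ S, y ∈ connectedComponentIn (O \ S) x ∧
      IsCompact (closure (connectedComponentIn (O \ S) x)) ∧
      closure (connectedComponentIn (O \ S) x) ⊆ O}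

/-- A primitive of `z ↦ z ^ (-d/2)` on the slit plane; `x ↦ kern d (‖x‖ ^ 2)` is, up to
a constant factor, the fundamental solution of the Laplacian in dimension `d`. -/
def kern (d : ℕ) (z : ℂ) : ℂ :=
  if d = 2 then Complex.log z else z ^ (1 - (d : ℂ) / 2) / (1 - (d : ℂ) / 2)

/-- The real version of `kern`. -/
def kernR (d : ℕ) (s : ℝ) : ℝ :=
  if d = 2 then Real.log s else s ^ (1 - (d : ℝ) / 2) / (1 - (d : ℝ) / 2)

theorem one_sub_half_ne_zero {d : ℕ} (hd : d ≠ 2) : (1 - (d : ℝ) / 2) ≠ 0 := by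
  intro h
  apply hd
  have : (d : ℝ) = 2 := by linarith
  exact_mod_cast this

theorem kern_ofReal (d : ℕ) {s : ℝ} (hs : 0 < s) : kern d s = (kernR d s : ℂ) := by
  unfold kern kernR
  split_ifs with h
  · exact (Complex.ofReal_log hs.le).symm
  · push_cast
    rw [Complex.ofReal_cpow hs.le]
    push_cast
    rfl

theorem hasDerivAt_kern (d : ℕ) {z : ℂ} (hz : z ∈ Complex.slitPlane) :
    HasDerivAt (kern d) (z ^ (-(d : ℂ) / 2)) z := by
  by_cases h : d = 2
  · subst h
    have := Complex.hasDerivAt_log hz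
    have e : kern 2 = Complex.log := by ext; simp [kern]
    rw [e]
    refine this.congr_deriv ?_
    norm_num [Complex.cpow_neg_one]
  · have e : kern d = fun z => z ^ (1 - (d : ℂ) / 2) / (1 - (d : ℂ) / 2) := by
      ext; simp [kern, h]
    have hne : (1 - (d : ℂ) / 2) ≠ 0 := by
      have := one_sub_half_ne_zero h
      intro hc
      apply this
      have := congrArg Complex.re hc
      simpa using this
    rw [e]
    have := ((hasDerivAt_id z).cpow_const (c := 1 - (d : ℂ) / 2) hz).div_const (1 - (d : ℂ) / 2)
    refine this.congr_deriv ?_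
    rw [mul_one, mul_div_cancel_left₀ _ hne]
    simp only [id]
    congr 1
    ring

theorem hasDerivAt_kernR (d : ℕ) {s : ℝ} (hs : 0 < s) :
    HasDerivAt (kernR d) (s ^ (-(d : ℝ) / 2)) s := by
  by_cases h : d = 2
  · subst h
    have := Real.hasDerivAt_log hs.ne'
    have e : kernR 2 = Real.log := by ext; simp [kernR]
    rw [e]
    refine this.congr_deriv ?_
    norm_num [Real.rpow_neg_one]
  · have e : kernR d = fun z => z ^ (1 - (d : ℝ) / 2) / (1 - (d : ℝ) / 2) := by
      ext; simp [kernR, h]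
    have hne := one_sub_half_ne_zero h
    rw [e]
    have := ((hasDerivAt_id s).rpow_const (p := 1 - (d : ℝ) / 2) (Or.inl hs.ne')).div_const
      (1 - (d : ℝ) / 2)
    refine this.congr_deriv ?_
    rw [one_mul, mul_div_cancel_left₀ _ hne]
    simp only [id]
    congr 1
    ring

theorem continuousOn_kernR (d : ℕ) : ContinuousOn (kernR d) (Ioi 0) := fun _ hs =>
  (hasDerivAt_kernR d hs).continuousAt.continuousWithinAt

theorem strictMonoOn_kernR (d : ℕ) : StrictMonoOn (kernR d) (Ioi 0) := by
  apply strictMonoOn_of_deriv_pos (convex_Ioi 0) (continuousOn_kernR d)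
  intro x hx
  rw [interior_Ioi] at hx
  rw [(hasDerivAt_kernR d hx).deriv]
  exact Real.rpow_pos_of_pos hx _

/-- The cut-off paraboloid `max (1 - ‖z‖ ^ 2) 0`. -/
def parab {d : ℕ} (z : Euc d) : ℝ := max (1 - ‖z‖ ^ 2) 0

theorem lipschitzWith_parab {d : ℕ} : LipschitzWith 2 (parab (d := d)) := by
  apply LipschitzWith.of_dist_le_mul
  intro x y
  have key : ∀ a b : ℝ, 0 ≤ a → 0 ≤ b → b ≤ a →
      |max (1 - a ^ 2) 0 - max (1 - b ^ 2) 0| ≤ 2 * |a - b| := by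
    intro a b ha hb hab
    rw [abs_of_nonneg (sub_nonneg.2 hab)]
    rcases le_total (1 - a ^ 2) 0 with h1 | h1 <;> rcases le_total (1 - b ^ 2) 0 with h2 | h2
    · rw [max_eq_right h1, max_eq_right h2]; simp [hab]
    · rw [max_eq_right h1, max_eq_left h2, abs_le]
      have : 1 ≤ a := by nlinarith
      constructor <;> nlinarith
    · rw [max_eq_left h1, max_eq_right h2, abs_le]
      constructor <;> nlinarith
    · rw [max_eq_left h1, max_eq_left h2, abs_le]
      have : a ≤ 1 := by nlinarith
      constructor <;> nlinarith
  have h : |parab x - parab y| ≤ 2 * |‖x‖ - ‖y‖| := by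
    rcases le_total ‖y‖ ‖x‖ with h | h
    · exact key _ _ (norm_nonneg _) (norm_nonneg _) h
    · rw [abs_sub_comm, abs_sub_comm ‖x‖]
      exact key _ _ (norm_nonneg _) (norm_nonneg _) h
  rw [Real.dist_eq, dist_eq_norm]
  refine h.trans ?_
  have := abs_norm_sub_norm_le x y
  norm_num
  linarith

theorem parab_of_one_le {d : ℕ} {z : Euc d} (hz : 1 ≤ ‖z‖) : parab z = 0 :=
  max_eq_right (by nlinarith)

theorem hasCompactSupport_parab {d : ℕ} : HasCompactSupport (parab (d := d)) := by
  apply HasCompactSupport.intro (isCompact_closedBall (0 : Euc d) 1)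
  intro x hx
  apply parab_of_one_le
  simp only [mem_closedBall, dist_zero_right, not_le] at hx
  exact hx.le

theorem lineDeriv_parab_of_lt {d : ℕ} {z : Euc d} (hz : ‖z‖ < 1) (v : Euc d) :
    lineDeriv ℝ parab z v = -2 * inner ℝ z v := by
  have h1 : parab =ᶠ[𝓝 z] fun z : Euc d => 1 - ‖z‖ ^ 2 := by
    have : ∀ᶠ w : Euc d in 𝓝 z, ‖w‖ < 1 := (isOpen_lt continuous_norm continuous_const).mem_nhds hz
    filter_upwards [this] with w hw
    exact max_eq_left (by nlinarith [norm_nonneg w])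
  rw [h1.lineDeriv_eq]
  have h2 : HasFDerivAt (fun z : Euc d => 1 - ‖z‖ ^ 2) (-(2 • (innerSL ℝ z))) z := by
    have := (hasStrictFDerivAt_norm_sq z).hasFDerivAt.const_sub 1
    exact this
  rw [(h2.hasLineDerivAt v).lineDeriv]
  simp

theorem lineDeriv_parab_of_gt {d : ℕ} {z : Euc d} (hz : 1 < ‖z‖) (v : Euc d) :
    lineDeriv ℝ parab z v = 0 := by
  have h1 : parab =ᶠ[𝓝 z] fun z : Euc d => (0 : ℝ) := by
    have : ∀ᶠ w : Euc d in 𝓝 z, 1 < ‖w‖ := (isOpen_lt continuous_const continuous_norm).mem_nhds hz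
    filter_upwards [this] with w hw
    exact parab_of_one_le hw.le
  rw [h1.lineDeriv_eq]
  exact ((hasFDerivAt_const (0 : ℝ) z).hasLineDerivAt v).lineDeriv

theorem exists_contDiff_eqOn_closedBall {d : ℕ} {f : Euc d → ℝ} {R : ℝ} (hR : 1 < R)
    (hf : ContDiffOn ℝ 1 f (ball 0 R)) :
    ∃ g : Euc d → ℝ, ContDiff ℝ 1 g ∧ HasCompactSupport g ∧ EqOn g f (closedBall 0 1) := by
  let b : ContDiffBump (0 : Euc d) := ⟨1, (1 + R) / 2, one_pos, by linarith⟩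
  refine ⟨fun z => b z * f z, ?_, b.hasCompactSupport.mul_right, ?_⟩
  · rw [contDiff_iff_contDiffAt]
    intro z
    by_cases hz : z ∈ ball (0 : Euc d) R
    · exact (b.contDiff.contDiffAt).mul (hf.contDiffAt (isOpen_ball.mem_nhds hz))
    · have hz' : z ∉ tsupport b := by
        rw [b.tsupport_eq]
        intro h
        apply hz
        rw [mem_closedBall] at h
        rw [mem_ball]
        have : b.rOut = (1 + R) / 2 := rfl
        rw [this] at h
        linarith
      have h0 : b =ᶠ[𝓝 z] 0 := notMem_tsupport_iff_eventuallyEq.1 hz'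
      have : (fun z => b z * f z) =ᶠ[𝓝 z] fun _ => 0 := by
        filter_upwards [h0] with w hw
        simp [hw]
      exact contDiffAt_const.congr_of_eventuallyEq this
  · intro z hz
    have : b z = 1 := b.one_of_mem_closedBall hz
    simp [this]

theorem integral_coord_mul_eq {d : ℕ} {f : Euc d → ℝ} {R : ℝ} (hR : 1 < R)
    (hf : ContDiffOn ℝ 1 f (ball 0 R)) (v : Euc d) :
    ∃ g : Euc d → ℝ, (∀ z ∈ ball (0 : Euc d) 1, g z = lineDeriv ℝ f z v * parab z) ∧
      (∀ z ∉ ball (0 : Euc d) 1, g z = 0) ∧ Integrable g ∧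
      ∫ z in closedBall (0 : Euc d) 1, inner ℝ z v * f z = (1 / 2) * ∫ z, g z := by
  obtain ⟨g, hg, hgc, hgf⟩ := exists_contDiff_eqOn_closedBall hR hf
  refine ⟨fun z => lineDeriv ℝ g z v * parab z, ?_, ?_, ?_, ?_⟩
  · intro z hz
    have : g =ᶠ[𝓝 z] f := by
      filter_upwards [isOpen_ball.mem_nhds hz] with w hw
      exact hgf (ball_subset_closedBall hw)
    simp only [this.lineDeriv_eq]
  · intro z hz
    have : parab z = 0 := parab_of_one_le (by simpa using hz)
    simp [this]
  · have hl : (fun z => lineDeriv ℝ g z v) = fun z => fderiv ℝ g z v := by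
      ext z
      exact ((hg.differentiable (by norm_num)).differentiableAt).lineDeriv_eq_fderiv
    apply Continuous.integrable_of_hasCompactSupport
    · rw [show (fun z => lineDeriv ℝ g z v * parab z) = fun z => fderiv ℝ g z v * parab z by
        ext z; rw [congrFun hl z]]
      exact ((hg.continuous_fderiv (by norm_num)).clm_apply continuous_const).mul
        lipschitzWith_parab.continuous
    · exact hasCompactSupport_parab.mul_left
  · obtain ⟨C, hC⟩ := hg.lipschitzWith_of_hasCompactSupport hgc (by norm_num)
    rw [hC.integral_lineDeriv_mul_eq lipschitzWith_parab hasCompactSupport_parab v]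
    rw [← integral_const_mul, ← integral_indicator isClosed_closedBall.measurableSet]
    rcases subsingleton_or_nontrivial (Euc d) with hs | hn
    · apply integral_congr_ae
      filter_upwards with z
      have hz : z = 0 := Subsingleton.elim _ _
      have hv : v = 0 := Subsingleton.elim _ _
      simp [hz, hv, lineDeriv]
    · apply integral_congr_ae
      have h0 : ∀ᵐ z : Euc d, z ∉ sphere (0 : Euc d) 1 := by
        rw [← measure_eq_zero_iff_ae_notMem]
        exact Measure.addHaar_sphere _ _ _
      filter_upwards [h0] with z hz
      rcases lt_trichotomy ‖z‖ 1 with h | h | h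
      · have hz1 : z ∈ closedBall (0 : Euc d) 1 := by simpa using h.le
        rw [indicator_of_mem hz1, lineDeriv_parab_of_lt h, hgf hz1, inner_neg_right]
        ring
      · exact absurd (by simpa using h) hz
      · have hz1 : z ∉ closedBall (0 : Euc d) 1 := by simpa using h
        rw [indicator_of_notMem hz1, lineDeriv_parab_of_gt h]
        ring

/-- If the components of a `C¹` vector field near the unit ball have zero divergence, then
the radial component of the field has zero integral over the ball. -/
theorem integral_radial_eq_zero {d : ℕ} {f : Fin d → Euc d → ℝ} {R : ℝ} (hR : 1 < R)
    (hf : ∀ i, ContDiffOn ℝ 1 (f i) (ball 0 R))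
    (hdiv : ∀ z ∈ ball (0 : Euc d) 1,
      ∑ i, lineDeriv ℝ (f i) z (EuclideanSpace.single i 1) = 0) :
    ∫ z in closedBall (0 : Euc d) 1, ∑ i, z i * f i z = 0 := by
  have hintg : ∀ i, IntegrableOn (fun z : Euc d => z i * f i z) (closedBall 0 1) := by
    intro i
    apply ContinuousOn.integrableOn_compact (isCompact_closedBall _ _)
    apply ContinuousOn.mul
    · fun_prop
    · exact (hf i).continuousOn.mono (closedBall_subset_ball hR)
  rw [integral_finsetSum _ fun i _ => hintg i]
  choose g hg1 hg2 hg3 hg4 using fun i =>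
    integral_coord_mul_eq hR (hf i) (EuclideanSpace.single i (1 : ℝ))
  have h5 : ∀ i, ∫ z in closedBall (0 : Euc d) 1, z i * f i z = (1 / 2) * ∫ z, g i z := by
    intro i
    rw [← hg4 i]
    congr 1
    ext z
    simp [EuclideanSpace.inner_single_right]
  simp_rw [h5]
  rw [← Finset.mul_sum, ← integral_finsetSum _ fun i _ => hg3 i]
  have : ∀ z, ∑ i, g i z = 0 := by
    intro z
    by_cases hz : z ∈ ball (0 : Euc d) 1
    · simp_rw [hg1 _ z hz]
      rw [← Finset.sum_mul, hdiv z hz, zero_mul]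
    · simp [hg2 _ z hz]
  simp [this]

/-- The fundamental solution of the Laplacian, up to a constant factor. -/
def fundSol {d : ℕ} (x : Euc d) : ℝ := kernR d (‖x‖ ^ 2)

theorem lineDeriv_field {d : ℕ} (c : Euc d) (s : ℝ) (z : Euc d) (h : c + s • z ≠ 0) (i : Fin d) :
    lineDeriv ℝ (fun z : Euc d => (c + s • z) i * (‖c + s • z‖ ^ 2) ^ (-(d : ℝ) / 2)) z
      (EuclideanSpace.single i 1) =
    s * (‖c + s • z‖ ^ 2) ^ (-(d : ℝ) / 2) -
      d * s * (c + s • z) i ^ 2 * (‖c + s • z‖ ^ 2) ^ (-(d : ℝ) / 2 - 1) := by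
  set p := c + s • z with hp
  set e : Euc d := EuclideanSpace.single i 1 with he
  have hlin : HasDerivAt (fun t : ℝ => c + s • (z + t • e)) (s • e) 0 := by
    have h1 : HasDerivAt (fun t : ℝ => z + t • e) e 0 := by
      simpa using ((hasDerivAt_id (0 : ℝ)).smul_const e).const_add z
    exact (h1.const_smul s).const_add c
  have hv0 : c + s • (z + (0 : ℝ) • e) = p := by simp [hp]
  have hcoord : HasDerivAt (fun t : ℝ => (c + s • (z + t • e)) i) s 0 := by
    have := ((EuclideanSpace.proj i : Euc d →L[ℝ] ℝ).hasFDerivAt.comp_hasDerivAt 0 hlin)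
    refine this.congr_deriv ?_
    simp [he]
  have hnorm : HasDerivAt (fun t : ℝ => ‖c + s • (z + t • e)‖ ^ 2) (2 * (s * p i)) 0 := by
    have := hlin.norm_sq
    rw [hv0] at this
    simpa [he, inner_smul_right, EuclideanSpace.inner_single_right] using this
  have hpos : 0 < ‖p‖ ^ 2 := by positivity
  have hpow : HasDerivAt (fun t : ℝ => (‖c + s • (z + t • e)‖ ^ 2) ^ (-(d : ℝ) / 2))
      (2 * (s * p i) * (-(d : ℝ) / 2) * (‖p‖ ^ 2) ^ (-(d : ℝ) / 2 - 1)) 0 := by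
    have := hnorm.rpow_const (p := -(d : ℝ) / 2) (Or.inl (by rw [hv0]; exact hpos.ne'))
    rwa [hv0] at this
  have hprod := hcoord.mul hpow
  rw [hv0] at hprod
  have : HasLineDerivAt ℝ (fun z : Euc d => (c + s • z) i * (‖c + s • z‖ ^ 2) ^ (-(d : ℝ) / 2))
      (s * (‖p‖ ^ 2) ^ (-(d : ℝ) / 2) +
        p i * (2 * (s * p i) * (-(d : ℝ) / 2) * (‖p‖ ^ 2) ^ (-(d : ℝ) / 2 - 1))) z e := hprod
  rw [this.lineDeriv]
  ring

theorem add_smul_ne_zero {d : ℕ} {c z : Euc d} {s : ℝ} (h : |s| * ‖z‖ < ‖c‖) : c + s • z ≠ 0 := by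
  intro h0
  have : c = -(s • z) := eq_neg_of_add_eq_zero_left h0
  rw [this, norm_neg, norm_smul, Real.norm_eq_abs] at h
  exact lt_irrefl _ h

theorem integral_field_eq_zero {d : ℕ} (c : Euc d) (s : ℝ) (hs : |s| < ‖c‖) :
    ∫ z in closedBall (0 : Euc d) 1,
      inner ℝ (c + s • z) z * (‖c + s • z‖ ^ 2) ^ (-(d : ℝ) / 2) = 0 := by
  have hs0 := abs_nonneg s
  set R : ℝ := 1 + (‖c‖ - |s|) / (|s| + 1) with hRdef
  have hR : 1 < R := by
    have : 0 < (‖c‖ - |s|) / (|s| + 1) := div_pos (by linarith) (by linarith)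
    linarith
  have hsR : |s| * R ≤ ‖c‖ := by
    have : |s| * ((‖c‖ - |s|) / (|s| + 1)) ≤ ‖c‖ - |s| := by
      rw [mul_div_assoc', div_le_iff₀ (by linarith)]
      nlinarith
    rw [hRdef, mul_add]
    linarith
  have hne : ∀ z ∈ ball (0 : Euc d) R, c + s • z ≠ 0 := by
    intro z hz
    rw [mem_ball_zero_iff] at hz
    apply add_smul_ne_zero
    rcases hs0.eq_or_lt with h | h
    · rw [← h] at hs ⊢; simpa using hs
    · nlinarith
  have key := integral_radial_eq_zero (d := d) (R := R)
    (f := fun i z => (c + s • z) i * (‖c + s • z‖ ^ 2) ^ (-(d : ℝ) / 2)) hR ?_ ?_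
  · rw [← key]
    congr 1
    ext z
    simp only [PiLp.inner_apply, RCLike.inner_apply, conj_trivial, Finset.sum_mul]
    exact Finset.sum_congr rfl fun i _ => by ring
  · intro i z hz
    apply ContDiffAt.contDiffWithinAt
    have h1 : ContDiffAt ℝ 1 (fun z : Euc d => c + s • z) z := by fun_prop
    apply ContDiffAt.mul
    · exact ((EuclideanSpace.proj i : Euc d →L[ℝ] ℝ).contDiff.contDiffAt).comp z h1
    · apply ContDiffAt.rpow_const_of_ne (h1.norm_sq ℝ)
      have := hne z hz
      positivity
  · intro z hz
    have hz' := hne z (ball_subset_ball hR.le hz)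
    simp_rw [lineDeriv_field c s z hz']
    rw [Finset.sum_sub_distrib, ← Finset.sum_mul, ← Finset.sum_mul, ← Finset.mul_sum]
    have hpos : 0 < ‖c + s • z‖ ^ 2 := by positivity
    have hn : ∑ i, (c + s • z) i ^ 2 = ‖c + s • z‖ ^ 2 := by
      rw [EuclideanSpace.norm_sq_eq]
      simp
    rw [hn, Real.rpow_sub_one hpos.ne']
    simp only [Finset.sum_const, Finset.card_univ, Fintype.card_fin, nsmul_eq_mul]
    field_simp
    ring

theorem hasDerivAt_fundSol_line {d : ℕ} (c z : Euc d) (s : ℝ) (h : c + s • z ≠ 0) :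
    HasDerivAt (fun s : ℝ => fundSol (c + s • z))
      (2 * (inner ℝ (c + s • z) z * (‖c + s • z‖ ^ 2) ^ (-(d : ℝ) / 2))) s := by
  have h1 : HasDerivAt (fun s : ℝ => c + s • z) z s := by
    simpa using ((hasDerivAt_id s).smul_const z).const_add c
  have := (hasDerivAt_kernR d (s := ‖c + s • z‖ ^ 2) (by positivity)).comp s h1.norm_sq
  refine this.congr_deriv ?_
  ring

theorem continuousAt_fundSol {d : ℕ} {x : Euc d} (hx : x ≠ 0) : ContinuousAt fundSol x := by
  have : ContinuousAt (kernR d) (‖x‖ ^ 2) :=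
    (hasDerivAt_kernR d (by positivity)).continuousAt
  exact ContinuousAt.comp (f := fun x : Euc d => ‖x‖ ^ 2) this (by fun_prop)

/-- The mean value property of the fundamental solution over balls avoiding the origin. -/
theorem integral_fundSol {d : ℕ} (c : Euc d) (s : ℝ) (hs : |s| < ‖c‖) :
    ∫ z in closedBall (0 : Euc d) 1, fundSol (c + s • z) =
      volume.real (closedBall (0 : Euc d) 1) * fundSol c := by
  have hder : ∀ σ ∈ Ioo (-‖c‖) ‖c‖, HasDerivAt
      (fun σ : ℝ => ∫ z in closedBall (0 : Euc d) 1, fundSol (c + σ • z)) 0 σ := by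
    intro σ hσ
    replace hσ : |σ| < ‖c‖ := abs_lt.2 hσ
    obtain ⟨ρ, hρ1, hρ2⟩ := exists_between hσ
    have hne : ∀ τ ∈ Ioo (-ρ) ρ, ∀ z ∈ closedBall (0 : Euc d) 1,
        ‖c‖ - ρ ≤ ‖c + τ • z‖ ∧ ‖c + τ • z‖ ≤ ‖c‖ + ρ := by
      intro τ hτ z hz
      replace hτ : |τ| < ρ := abs_lt.2 hτ
      rw [mem_closedBall_zero_iff] at hz
      have h1 : ‖τ • z‖ ≤ ρ := by
        rw [norm_smul, Real.norm_eq_abs]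
        nlinarith [abs_nonneg τ, norm_nonneg z]
      constructor
      · have := norm_sub_le (c + τ • z) (τ • z)
        rw [add_sub_cancel_right] at this
        linarith
      · have := norm_add_le c (τ • z)
        linarith
    have hne0 : ∀ τ ∈ Ioo (-ρ) ρ, ∀ z ∈ closedBall (0 : Euc d) 1, c + τ • z ≠ 0 := by
      intro τ hτ z hz h0
      have := (hne τ hτ z hz).1
      rw [h0, norm_zero] at this
      linarith
    have hcont : ∀ τ ∈ Ioo (-ρ) ρ,
        ContinuousOn (fun z : Euc d => fundSol (c + τ • z)) (closedBall 0 1) := by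
      intro τ hτ z hz
      apply ContinuousAt.continuousWithinAt
      exact ContinuousAt.comp (f := fun z : Euc d => c + τ • z)
        (continuousAt_fundSol (hne0 τ hτ z hz)) (by fun_prop)
    have hσ' : σ ∈ Ioo (-ρ) ρ := abs_lt.1 hρ1
    have := hasDerivAt_integral_of_dominated_loc_of_deriv_le
      (μ := volume.restrict (closedBall (0 : Euc d) 1)) (𝕜 := ℝ)
      (F := fun σ z => fundSol (c + σ • z)) (x₀ := σ) (s := Ioo (-ρ) ρ)
      (F' := fun s z => 2 * (inner ℝ (c + s • z) z * (‖c + s • z‖ ^ 2) ^ (-(d : ℝ) / 2)))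
      (bound := fun _ => 2 * ((‖c‖ + ρ) * ((‖c‖ - ρ) ^ 2) ^ (-(d : ℝ) / 2)))
      (isOpen_Ioo.mem_nhds hσ') ?_ ?_ ?_ ?_ ?_ ?_
    · have h2 := this.2
      rwa [integral_const_mul, integral_field_eq_zero c σ hσ, mul_zero] at h2
    · filter_upwards [isOpen_Ioo.mem_nhds hσ'] with τ hτ
      exact (hcont τ hτ).aestronglyMeasurable isClosed_closedBall.measurableSet
    · exact (hcont σ hσ').integrableOn_compact (isCompact_closedBall _ _)
    · apply ContinuousOn.aestronglyMeasurable _ isClosed_closedBall.measurableSet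
      apply ContinuousOn.mul continuousOn_const
      apply ContinuousOn.mul
      · fun_prop
      · apply ContinuousOn.rpow_const
        · fun_prop
        · intro z hz
          have := hne0 σ hσ' z hz
          left
          positivity
    · filter_upwards [ae_restrict_mem isClosed_closedBall.measurableSet] with z hz τ hτ
      obtain ⟨h1, h2⟩ := hne τ hτ z hz
      have h3 : |inner ℝ (c + τ • z) z| ≤ ‖c‖ + ρ := by
        refine (abs_real_inner_le_norm _ _).trans ?_
        rw [mem_closedBall_zero_iff] at hz
        nlinarith [norm_nonneg z, norm_nonneg (c + τ • z)]
      have h4 : (‖c + τ • z‖ ^ 2) ^ (-(d : ℝ) / 2) ≤ ((‖c‖ - ρ) ^ 2) ^ (-(d : ℝ) / 2) := by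
        apply Real.rpow_le_rpow_of_nonpos
        · have : 0 < ‖c‖ - ρ := by linarith
          positivity
        · gcongr
        · have : (0 : ℝ) ≤ d := by positivity
          linarith
      rw [Real.norm_eq_abs, abs_mul, abs_mul, abs_two,
        abs_of_nonneg (Real.rpow_nonneg (by positivity : (0 : ℝ) ≤ ‖c + τ • z‖ ^ 2) _)]
      gcongr
      exact (abs_nonneg _).trans h3
    · exact integrableOn_const measure_closedBall_lt_top.ne
    · filter_upwards [ae_restrict_mem isClosed_closedBall.measurableSet] with z hz τ hτ
      exact hasDerivAt_fundSol_line c z τ (hne0 τ hτ z hz)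
  have hconst := (convex_Ioo (-‖c‖) ‖c‖).norm_image_sub_le_of_norm_hasDerivWithin_le (C := 0)
    (fun σ hσ => (hder σ hσ).hasDerivWithinAt) (by simp)
    (x := 0) (y := s) ⟨by linarith [abs_nonneg s], by linarith [abs_nonneg s]⟩ (abs_lt.1 hs)
  rw [zero_mul, norm_le_zero_iff, sub_eq_zero] at hconst
  rw [hconst]
  simp

theorem setIntegral_closedBall_eq {d : ℕ} {F : Type*} [NormedAddCommGroup F] [NormedSpace ℝ F]
    (f : Euc d → F) (x : Euc d) {r : ℝ} (hr : 0 < r) :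
    ∫ y in closedBall x r, f y = r ^ d • ∫ z in closedBall (0 : Euc d) 1, f (x + r • z) := by
  have h1 := Measure.setIntegral_comp_smul_of_pos (volume : Measure (Euc d))
    (fun y => f (x + y)) (closedBall (0 : Euc d) 1) hr
  rw [h1, finrank_euclideanSpace, Fintype.card_fin, smul_smul, mul_inv_cancel₀ (by positivity),
    one_smul, smul_unitClosedBall_of_nonneg hr.le]
  have h2 := (measurePreserving_add_left (volume : Measure (Euc d)) x).setIntegral_preimage_emb
    (measurableEmbedding_addLeft x) f (closedBall x r)
  rw [← h2]
  congr 2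
  ext y
  simp

theorem volume_real_unitBall_pos (d : ℕ) : 0 < volume.real (closedBall (0 : Euc d) 1) := by
  rw [Measure.real, ENNReal.toReal_pos_iff]
  exact ⟨measure_closedBall_pos _ _ one_pos, measure_closedBall_lt_top⟩

theorem volume_real_closedBall {d : ℕ} (x : Euc d) {r : ℝ} (hr : 0 < r) :
    volume.real (closedBall x r) = r ^ d * volume.real (closedBall (0 : Euc d) 1) := by
  have := setIntegral_closedBall_eq (fun _ => (1 : ℝ)) x hr
  simpa using this

theorem eq_setAverage_iff {d : ℕ} (h : Euc d → ℝ) (x : Euc d) {r : ℝ} (hr : 0 < r) :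
    h x = ⨍ y in closedBall x r, h y ∂volume ↔
      ∫ y in closedBall x r, h y = volume.real (closedBall x r) * h x := by
  have h1 := volume_real_unitBall_pos d
  have h2 : 0 < volume.real (closedBall x r) := by
    rw [volume_real_closedBall x hr]; positivity
  rw [setAverage_eq, smul_eq_mul]
  constructor
  · intro h3
    rw [h3, mul_inv_cancel_left₀ h2.ne']
  · intro h3
    rw [h3, inv_mul_cancel_left₀ h2.ne']

theorem eq_setAverage_iff_unit {d : ℕ} (h : Euc d → ℝ) (x : Euc d) {r : ℝ} (hr : 0 < r) :
    h x = ⨍ y in closedBall x r, h y ∂volume ↔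
      ∫ z in closedBall (0 : Euc d) 1, h (x + r • z) =
        volume.real (closedBall (0 : Euc d) 1) * h x := by
  rw [eq_setAverage_iff h x hr, setIntegral_closedBall_eq h x hr, volume_real_closedBall x hr,
    smul_eq_mul, mul_assoc]
  exact mul_right_inj' (by positivity)

theorem HarmOn.integral_unitBall {d : ℕ} {h : Euc d → ℝ} {O : Set (Euc d)} (hh : HarmOn h O)
    {x : Euc d} {r : ℝ} (hr : 0 < r) (hx : closedBall x r ⊆ O) :
    ∫ z in closedBall (0 : Euc d) 1, h (x + r • z) =
      volume.real (closedBall (0 : Euc d) 1) * h x :=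
  (eq_setAverage_iff_unit h x hr).1 (hh.2 x r hr hx)

/-- Mean value property of affine pullbacks of the fundamental solution. -/
theorem setIntegral_fundSol_affine {d : ℕ} (a t : ℝ) (b : Euc d) (x : Euc d) {r : ℝ} (hr : 0 < r)
    (h : |t| * r < ‖a • b + t • x‖) :
    ∫ y in closedBall x r, fundSol (a • b + t • y) =
      volume.real (closedBall x r) * fundSol (a • b + t • x) := by
  rw [setIntegral_closedBall_eq _ x hr, volume_real_closedBall x hr, mul_assoc, smul_eq_mul]
  congr 1
  rw [← integral_fundSol (a • b + t • x) (t * r) (by rwa [abs_mul, abs_of_pos hr])]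
  congr 1
  ext z
  congr 1
  module

section HolomorphicParameter

variable {d : ℕ} {K : Set (Euc d)} {ν : Measure (Euc d)} [IsFiniteMeasure ν] {ρ : ℝ}
  {Φ Φ' : ℂ → Euc d → ℂ}

theorem differentiableOn_setIntegral_param (hK : IsCompact K)
    (hc : ContinuousOn (Function.uncurry Φ) (ball 0 ρ ×ˢ K))
    (hc' : ContinuousOn (Function.uncurry Φ') (ball 0 ρ ×ˢ K))
    (hd : ∀ x ∈ K, ∀ t ∈ ball (0 : ℂ) ρ, HasDerivAt (fun t => Φ t x) (Φ' t x) t) :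
    DifferentiableOn ℂ (fun t => ∫ x in K, Φ t x ∂ν) (ball 0 ρ) := by
  intro t ht
  apply DifferentiableAt.differentiableWithinAt
  obtain ⟨ε, hε, hεs⟩ := Metric.isOpen_iff.1 isOpen_ball t ht
  have hsub : closedBall t (ε / 2) ⊆ ball 0 ρ :=
    (closedBall_subset_ball (by linarith)).trans hεs
  obtain ⟨C, hC⟩ := ((isCompact_closedBall t (ε / 2)).prod hK).exists_bound_of_continuousOn
    (hc'.mono (prod_mono hsub subset_rfl))
  have sec : ∀ {Ψ : ℂ → Euc d → ℂ}, ContinuousOn (Function.uncurry Ψ) (ball 0 ρ ×ˢ K) →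
      ∀ s ∈ ball (0 : ℂ) ρ, ContinuousOn (Ψ s) K := by
    intro Ψ hΨ s hs
    exact hΨ.comp (f := fun x => (s, x)) (by fun_prop) fun x hx => ⟨hs, hx⟩
  have := hasDerivAt_integral_of_dominated_loc_of_deriv_le (μ := ν.restrict K) (𝕜 := ℂ)
    (F := Φ) (F' := Φ') (x₀ := t) (s := closedBall t (ε / 2)) (bound := fun _ => C)
    (closedBall_mem_nhds t (by linarith)) ?_ ?_ ?_ ?_ ?_ ?_
  · exact this.2.differentiableAt
  · filter_upwards [isOpen_ball.mem_nhds ht] with s hs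
    exact (sec hc s hs).aestronglyMeasurable hK.measurableSet
  · exact (sec hc t ht).integrableOn_compact hK
  · exact (sec hc' t ht).aestronglyMeasurable hK.measurableSet
  · filter_upwards [ae_restrict_mem hK.measurableSet] with x hx s hs
    exact hC (s, x) ⟨hs, hx⟩
  · exact integrable_const _
  · filter_upwards [ae_restrict_mem hK.measurableSet] with x hx s hs
    exact hd x hx s (hsub hs)

theorem iteratedDeriv_eq_intervalIntegral {f : ℂ → ℂ} (hρ : 0 < ρ)
    (hf : DifferentiableOn ℂ f (ball 0 ρ)) (n : ℕ) :
    iteratedDeriv n f 0 = (2 * Real.pi * Complex.I / n.factorial)⁻¹ *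
      ∫ θ in (0 : ℝ)..2 * Real.pi, deriv (circleMap 0 (ρ / 2)) θ *
        (1 / circleMap 0 (ρ / 2) θ ^ (n + 1)) * f (circleMap 0 (ρ / 2) θ) := by
  have h := (hf.mono (closedBall_subset_ball (by linarith : ρ / 2 < ρ))
    ).circleIntegral_one_div_sub_center_pow_smul (by linarith) n
  have hne : (2 * Real.pi * Complex.I / n.factorial : ℂ) ≠ 0 :=
    div_ne_zero Complex.two_pi_I_ne_zero (by exact_mod_cast n.factorial_ne_zero)
  rw [smul_eq_mul] at h
  rw [eq_inv_mul_iff_mul_eq₀ hne, ← h, circleIntegral]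
  congr 1
  ext θ
  simp [mul_assoc]

theorem circleMap_half_mem (hρ : 0 < ρ) (θ : ℝ) : circleMap 0 (ρ / 2) θ ∈ ball (0 : ℂ) ρ := by
  rw [mem_ball_zero_iff, norm_circleMap_zero, abs_of_pos (by linarith)]
  linarith

theorem continuousOn_cauchy_integrand (hρ : 0 < ρ)
    (hc : ContinuousOn (Function.uncurry Φ) (ball 0 ρ ×ˢ K)) (n : ℕ) :
    ContinuousOn (fun p : ℝ × Euc d => deriv (circleMap 0 (ρ / 2)) p.1 *
        (1 / circleMap 0 (ρ / 2) p.1 ^ (n + 1)) * Φ (circleMap 0 (ρ / 2) p.1) p.2)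
      (univ ×ˢ K) := by
  apply ContinuousOn.mul
  · apply Continuous.continuousOn
    apply Continuous.mul
    · simp only [deriv_circleMap]
      fun_prop
    · apply Continuous.div continuous_const
      · fun_prop
      · intro p
        apply pow_ne_zero
        exact circleMap_ne_center (by linarith)
  · exact hc.comp (f := fun p : ℝ × Euc d => (circleMap 0 (ρ / 2) p.1, p.2)) (by fun_prop)
      fun p hp => ⟨circleMap_half_mem hρ _, hp.2⟩

theorem continuousOn_iteratedDeriv_param (hρ : 0 < ρ)
    (hc : ContinuousOn (Function.uncurry Φ) (ball 0 ρ ×ˢ K))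
    (hd : ∀ x ∈ K, DifferentiableOn ℂ (fun t => Φ t x) (ball 0 ρ)) (n : ℕ) :
    ContinuousOn (fun x => iteratedDeriv n (fun t => Φ t x) 0) K := by
  have : EqOn (fun x => iteratedDeriv n (fun t => Φ t x) 0)
      (fun x => (2 * Real.pi * Complex.I / n.factorial)⁻¹ *
      ∫ θ in (0 : ℝ)..2 * Real.pi, deriv (circleMap 0 (ρ / 2)) θ *
        (1 / circleMap 0 (ρ / 2) θ ^ (n + 1)) * Φ (circleMap 0 (ρ / 2) θ) x) K :=
    fun x hx => iteratedDeriv_eq_intervalIntegral hρ (hd x hx) n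
  apply ContinuousOn.congr _ this
  apply continuousOn_const.mul
  rw [continuousOn_iff_continuous_domRestrict]
  apply intervalIntegral.continuous_parametric_intervalIntegral_of_continuous'
    (f := fun (x : K) θ => deriv (circleMap 0 (ρ / 2)) θ *
        (1 / circleMap 0 (ρ / 2) θ ^ (n + 1)) * Φ (circleMap 0 (ρ / 2) θ) x)
  have := (continuousOn_cauchy_integrand hρ hc n).comp_continuous
    (f := fun p : K × ℝ => (p.2, (p.1 : Euc d))) (by fun_prop) (fun p => ⟨trivial, p.1.2⟩)
  exact this

theorem setIntegral_iteratedDeriv_param (hK : IsCompact K) (hρ : 0 < ρ)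
    (hc : ContinuousOn (Function.uncurry Φ) (ball 0 ρ ×ˢ K))
    (hd : ∀ x ∈ K, DifferentiableOn ℂ (fun t => Φ t x) (ball 0 ρ))
    (hF : DifferentiableOn ℂ (fun t => ∫ x in K, Φ t x ∂ν) (ball 0 ρ)) (n : ℕ) :
    ∫ x in K, iteratedDeriv n (fun t => Φ t x) 0 ∂ν =
      iteratedDeriv n (fun t => ∫ x in K, Φ t x ∂ν) 0 := by
  rw [iteratedDeriv_eq_intervalIntegral hρ hF n]
  rw [setIntegral_congr_fun hK.measurableSet
    fun x hx => iteratedDeriv_eq_intervalIntegral hρ (hd x hx) n]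
  rw [integral_const_mul]
  congr 1
  simp_rw [intervalIntegral.integral_of_le Real.two_pi_pos.le, ← integral_const_mul]
  apply integral_integral_swap
  rw [Measure.prod_restrict]
  have h1 := (continuousOn_cauchy_integrand hρ hc n).mono
    (prod_mono (subset_univ (Icc 0 (2 * Real.pi))) subset_rfl)
  have h2 := h1.comp (f := Prod.swap) (s := K ×ˢ Icc 0 (2 * Real.pi)) (by fun_prop)
    fun p hp => ⟨hp.2, hp.1⟩
  exact (h2.integrableOn_compact (hK.prod isCompact_Icc)).mono_set
    (prod_mono subset_rfl Ioc_subset_Icc_self)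

end HolomorphicParameter

/-- The complexification in `t` of `‖a + t • b‖ ^ 2`. -/
def cquad {d : ℕ} (a b : Euc d) (t : ℂ) : ℂ :=
  (‖a‖ ^ 2 : ℝ) + 2 * t * (inner ℝ a b : ℝ) + t ^ 2 * (‖b‖ ^ 2 : ℝ)

/-- The complexification in `t` of `fundSol (a + t • b)`. -/
def cfund {d : ℕ} (a b : Euc d) (t : ℂ) : ℂ := kern d (cquad a b t)

theorem cquad_mem_slitPlane {d : ℕ} {a b : Euc d} {t : ℂ} (ha : a ≠ 0)
    (h : 4 * ‖t‖ * ‖b‖ ≤ ‖a‖) : cquad a b t ∈ Complex.slitPlane := by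
  left
  have hre : (cquad a b t).re =
      ‖a‖ ^ 2 + 2 * t.re * inner ℝ a b + (t.re ^ 2 - t.im ^ 2) * ‖b‖ ^ 2 := by
    simp only [cquad, Complex.add_re, Complex.re_mul_ofReal, Complex.ofReal_re]
    simp [pow_two]
  have hn : t.re ^ 2 + t.im ^ 2 = ‖t‖ ^ 2 := by
    rw [← Complex.normSq_eq_norm_sq, Complex.normSq_apply]; ring
  have h1 : |t.re * inner ℝ a b| ≤ ‖t‖ * (‖a‖ * ‖b‖) := by
    rw [abs_mul]
    exact mul_le_mul (Complex.abs_re_le_norm t) (abs_real_inner_le_norm a b) (abs_nonneg _)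
      (norm_nonneg _)
  have h2 := (abs_le.1 h1).1
  have ha' : 0 < ‖a‖ := norm_pos_iff.2 ha
  have h3 : 0 ≤ ‖t‖ * ‖b‖ := by positivity
  have h4 : (‖t‖ * ‖b‖) ^ 2 ≤ (‖a‖ / 4) ^ 2 := by
    gcongr
    linarith
  have h5 : ‖t‖ * ‖b‖ * ‖a‖ ≤ ‖a‖ / 4 * ‖a‖ := by
    gcongr
    linarith
  have h6 : -(‖t‖ ^ 2 * ‖b‖ ^ 2) ≤ (t.re ^ 2 - t.im ^ 2) * ‖b‖ ^ 2 := by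
    rw [← hn]
    nlinarith [mul_nonneg (sq_nonneg t.re) (sq_nonneg ‖b‖)]
  rw [hre]
  nlinarith

theorem hasDerivAt_cfund {d : ℕ} {a b : Euc d} {t : ℂ} (ha : a ≠ 0)
    (h : 4 * ‖t‖ * ‖b‖ ≤ ‖a‖) :
    HasDerivAt (cfund a b) (cquad a b t ^ (-(d : ℂ) / 2) *
      (2 * (inner ℝ a b : ℝ) + 2 * t * (‖b‖ ^ 2 : ℝ))) t := by
  have h1 : HasDerivAt (cquad a b) (2 * (inner ℝ a b : ℝ) + 2 * t * (‖b‖ ^ 2 : ℝ)) t := by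
    have e1 := (((hasDerivAt_id t).const_mul 2).mul_const ((inner ℝ a b : ℝ) : ℂ)).const_add
      ((‖a‖ ^ 2 : ℝ) : ℂ)
    have e2 := ((hasDerivAt_id t).pow 2).mul_const ((‖b‖ ^ 2 : ℝ) : ℂ)
    refine (e1.add e2).congr_deriv ?_
    simp
  exact (hasDerivAt_kern d (cquad_mem_slitPlane ha h)).comp t h1

theorem cfund_ofReal {d : ℕ} {a b : Euc d} {t : ℝ} (h : a + t • b ≠ 0) :
    cfund a b t = (fundSol (a + t • b) : ℝ) := by
  have : cquad a b t = ((‖a + t • b‖ ^ 2 : ℝ) : ℂ) := by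
    rw [norm_add_sq_real, inner_smul_right, norm_smul, mul_pow, Real.norm_eq_abs, sq_abs]
    simp only [cquad]
    push_cast
    ring
  rw [cfund, this, kern_ofReal _ (by positivity), fundSol]

/-- Two holomorphic functions agreeing at small real arguments agree. -/
theorem eqOn_ball_of_eq_ofReal {f g : ℂ → ℂ} {ρ ε : ℝ} (hρ : 0 < ρ)
    (hf : DifferentiableOn ℂ f (ball 0 ρ)) (hg : DifferentiableOn ℂ g (ball 0 ρ)) (hε : 0 < ε)
    (h : ∀ t : ℝ, |t| < ε → f t = g t) : EqOn f g (ball 0 ρ) := by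
  apply AnalyticOnNhd.eqOn_of_preconnected_of_frequently_eq (z₀ := 0)
    (hf.analyticOnNhd isOpen_ball) (hg.analyticOnNhd isOpen_ball)
    (convex_ball _ _).isPreconnected (mem_ball_self hρ)
  have h1 : Tendsto (fun t : ℝ => (t : ℂ)) (𝓝[≠] 0) (𝓝[≠] 0) := by
    apply tendsto_nhdsWithin_of_tendsto_nhds_of_eventually_within
    · have := Complex.continuous_ofReal.tendsto 0
      rw [Complex.ofReal_zero] at this
      exact this.mono_left nhdsWithin_le_nhds
    · filter_upwards [self_mem_nhdsWithin] with t ht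
      simpa using ht
  apply h1.frequently
  apply Eventually.frequently
  have : ∀ᶠ t : ℝ in 𝓝 0, |t| < ε := by
    have := Metric.ball_mem_nhds (0 : ℝ) hε
    filter_upwards [this] with t ht
    simpa using ht
  filter_upwards [nhdsWithin_le_nhds this] with t ht
  exact h t ht

/-- The condition ensuring that `t ↦ cfund (a x) (b x) t` is holomorphic on the ball of
radius `ρ` for all `x ∈ K`. -/
def Separated {d : ℕ} (a b : Euc d → Euc d) (ρ : ℝ) (K : Set (Euc d)) : Prop :=
  ∀ x ∈ K, a x ≠ 0 ∧ 4 * ρ * ‖b x‖ ≤ ‖a x‖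

/-- Taylor coefficients (up to factorials) of the complexified kernel. -/
def coeffFn {d : ℕ} (a b : Euc d → Euc d) (n : ℕ) (x : Euc d) : ℂ :=
  iteratedDeriv n (fun t => cfund (a x) (b x) t) 0

section Separated

variable {d : ℕ} {a b : Euc d → Euc d} {ρ : ℝ} {K : Set (Euc d)}

theorem Separated.apply (h : Separated a b ρ K) {x : Euc d} (hx : x ∈ K) {t : ℂ}
    (ht : t ∈ ball (0 : ℂ) ρ) : a x ≠ 0 ∧ 4 * ‖t‖ * ‖b x‖ ≤ ‖a x‖ := by
  obtain ⟨h1, h2⟩ := h x hx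
  refine ⟨h1, le_trans ?_ h2⟩
  rw [mem_ball_zero_iff] at ht
  gcongr

theorem Separated.add_smul_ne_zero (h : Separated a b ρ K) {x : Euc d} (hx : x ∈ K) {t : ℝ}
    (ht : |t| < ρ) : a x + t • b x ≠ 0 := by
  obtain ⟨h1, h2⟩ := h x hx
  have h1' : 0 < ‖a x‖ := norm_pos_iff.2 h1
  intro h0
  have : a x = -(t • b x) := eq_neg_of_add_eq_zero_left h0
  have h3 : ‖a x‖ = |t| * ‖b x‖ := by
    conv_lhs => rw [this]
    rw [norm_neg, norm_smul, Real.norm_eq_abs]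
  have h4 : |t| * ‖b x‖ ≤ ρ * ‖b x‖ := by gcongr
  linarith

theorem continuousOn_cquad (ha : Continuous a) (hb : Continuous b) :
    Continuous fun p : ℂ × Euc d => cquad (a p.2) (b p.2) p.1 := by
  unfold cquad
  have h1 : Continuous fun p : ℂ × Euc d => a p.2 := ha.comp continuous_snd
  have h2 : Continuous fun p : ℂ × Euc d => b p.2 := hb.comp continuous_snd
  have h3 : Continuous fun p : ℂ × Euc d => (inner ℝ (a p.2) (b p.2) : ℝ) := h1.inner h2
  fun_prop

theorem Separated.continuousOn (h : Separated a b ρ K) (ha : Continuous a) (hb : Continuous b) :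
    ContinuousOn (Function.uncurry fun t x => cfund (a x) (b x) t) (ball 0 ρ ×ˢ K) := by
  rintro ⟨t, x⟩ ⟨ht, hx⟩
  obtain ⟨h1, h2⟩ := h.apply hx ht
  apply ContinuousAt.continuousWithinAt
  exact ContinuousAt.comp (f := fun p : ℂ × Euc d => cquad (a p.2) (b p.2) p.1)
    (hasDerivAt_kern d (cquad_mem_slitPlane h1 h2)).continuousAt
    (continuousOn_cquad ha hb).continuousAt

theorem Separated.continuousOn_deriv (h : Separated a b ρ K) (ha : Continuous a)
    (hb : Continuous b) :
    ContinuousOn (Function.uncurry fun t x => cquad (a x) (b x) t ^ (-(d : ℂ) / 2) *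
      (2 * (inner ℝ (a x) (b x) : ℝ) + 2 * t * (‖b x‖ ^ 2 : ℝ))) (ball 0 ρ ×ˢ K) := by
  apply ContinuousOn.mul
  · apply (continuousOn_cquad ha hb).continuousOn.cpow_const
    rintro ⟨t, x⟩ ⟨ht, hx⟩
    obtain ⟨h1, h2⟩ := h.apply hx ht
    exact cquad_mem_slitPlane h1 h2
  · have h1 : Continuous fun p : ℂ × Euc d => a p.2 := ha.comp continuous_snd
    have h2 : Continuous fun p : ℂ × Euc d => b p.2 := hb.comp continuous_snd
    have h3 : Continuous fun p : ℂ × Euc d => (inner ℝ (a p.2) (b p.2) : ℝ) := h1.inner h2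
    fun_prop

theorem Separated.differentiableOn (h : Separated a b ρ K) {x : Euc d} (hx : x ∈ K) :
    DifferentiableOn ℂ (fun t => cfund (a x) (b x) t) (ball 0 ρ) := fun _ ht =>
  (hasDerivAt_cfund (h.apply hx ht).1 (h.apply hx ht).2).differentiableAt.differentiableWithinAt

theorem Separated.differentiableOn_integral (h : Separated a b ρ K) (ha : Continuous a)
    (hb : Continuous b) (hK : IsCompact K) (ν : Measure (Euc d)) [IsFiniteMeasure ν] :
    DifferentiableOn ℂ (fun t => ∫ x in K, cfund (a x) (b x) t ∂ν) (ball 0 ρ) :=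
  differentiableOn_setIntegral_param hK (h.continuousOn ha hb) (h.continuousOn_deriv ha hb)
    fun _ hx _ ht => hasDerivAt_cfund (h.apply hx ht).1 (h.apply hx ht).2

theorem Separated.integral_coeffFn (h : Separated a b ρ K) (ha : Continuous a)
    (hb : Continuous b) (hρ : 0 < ρ) (hK : IsCompact K) (ν : Measure (Euc d)) [IsFiniteMeasure ν]
    (n : ℕ) : ∫ x in K, coeffFn a b n x ∂ν =
      iteratedDeriv n (fun t => ∫ x in K, cfund (a x) (b x) t ∂ν) 0 :=
  setIntegral_iteratedDeriv_param hK hρ (h.continuousOn ha hb) (fun _ hx => h.differentiableOn hx)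
    (h.differentiableOn_integral ha hb hK ν) n

theorem Separated.continuousOn_coeffFn (h : Separated a b ρ K) (ha : Continuous a)
    (hb : Continuous b) (hρ : 0 < ρ) (n : ℕ) : ContinuousOn (coeffFn a b n) K :=
  continuousOn_iteratedDeriv_param hρ (h.continuousOn ha hb) (fun _ hx => h.differentiableOn hx) n

theorem Separated.integral_ofReal (h : Separated a b ρ K) (hK : IsCompact K)
    (ν : Measure (Euc d)) {t : ℝ} (ht : |t| < ρ) :
    ∫ x in K, cfund (a x) (b x) t ∂ν = ((∫ x in K, fundSol (a x + t • b x) ∂ν : ℝ) : ℂ) := by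
  rw [← integral_complex_ofReal]
  exact setIntegral_congr_fun hK.measurableSet fun x hx => cfund_ofReal (h.add_smul_ne_zero hx ht)

end Separated

/-- Taylor coefficients of a harmonic family are harmonic. -/
theorem harmOn_coeffFn {d : ℕ} {a b : Euc d → Euc d} (ha : Continuous a) (hb : Continuous b)
    {O : Set (Euc d)} (hO : IsOpen O)
    (h : ∀ x r, 0 < r → closedBall x r ⊆ O → ∃ ρ > 0, Separated a b ρ (closedBall x r) ∧
      ∀ t : ℝ, |t| < ρ → ∫ y in closedBall x r, fundSol (a y + t • b y) =
        volume.real (closedBall x r) * fundSol (a x + t • b x)) (n : ℕ) :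
    ContinuousOn (coeffFn a b n) O ∧ HarmOn (fun x => (coeffFn a b n x).re) O ∧
      HarmOn (fun x => (coeffFn a b n x).im) O := by
  have hcont : ContinuousOn (coeffFn a b n) O := by
    intro x hx
    obtain ⟨r, hr, hrO⟩ := Metric.nhds_basis_closedBall.mem_iff.1 (hO.mem_nhds hx)
    obtain ⟨ρ, hρ, hsep, -⟩ := h x r hr hrO
    exact ((hsep.continuousOn_coeffFn ha hb hρ n).continuousAt
      (closedBall_mem_nhds x hr)).continuousWithinAt
  have hmean : ∀ x r, 0 < r → closedBall x r ⊆ O →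
      ∫ y in closedBall x r, coeffFn a b n y =
        (volume.real (closedBall x r) : ℂ) * coeffFn a b n x := by
    intro x r hr hxr
    obtain ⟨ρ, hρ, hsep, hm⟩ := h x r hr hxr
    have hK := isCompact_closedBall x r
    have hxm : x ∈ closedBall x r := mem_closedBall_self hr.le
    have : IsFiniteMeasure ((volume : Measure (Euc d)).restrict (closedBall x r)) :=
      isFiniteMeasure_restrict.2 measure_closedBall_lt_top.ne
    have hd := hsep.differentiableOn_integral ha hb hK (volume.restrict (closedBall x r))
    have hi := hsep.integral_coeffFn ha hb hρ hK (volume.restrict (closedBall x r)) n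
    rw [Measure.restrict_restrict_of_subset subset_rfl] at hd hi
    rw [hi]
    have heq := eqOn_ball_of_eq_ofReal hρ hd
      ((hsep.differentiableOn hxm).const_mul (volume.real (closedBall x r) : ℂ)) hρ
      (fun t ht => by
        rw [hsep.integral_ofReal hK _ ht, hm t ht, cfund_ofReal (hsep.add_smul_ne_zero hxm ht)]
        push_cast
        rfl)
    have hev := heq.eventuallyEq_of_mem (isOpen_ball.mem_nhds (mem_ball_self hρ))
    rw [hev.iteratedDeriv_eq n]
    rw [iteratedDeriv_const_mul_field]
    rfl
  refine ⟨hcont, ⟨Complex.continuous_re.comp_continuousOn hcont, ?_⟩,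
    ⟨Complex.continuous_im.comp_continuousOn hcont, ?_⟩⟩
  all_goals
    intro x r hr hxr
    apply (eq_setAverage_iff _ x hr).2
    have hintg : IntegrableOn (coeffFn a b n) (closedBall x r) :=
      (hcont.mono hxr).integrableOn_compact (isCompact_closedBall x r)
    have := hmean x r hr hxr
  · have h2 := Complex.reCLM.integral_comp_comm hintg
    simp only [Complex.reCLM_apply] at h2
    rw [h2, this, Complex.re_ofReal_mul]
  · have h2 := Complex.imCLM.integral_comp_comm hintg
    simp only [Complex.imCLM_apply] at h2
    rw [h2, this, Complex.im_ofReal_mul]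

/-- Equality at `y` of the potentials of two measures. -/
def EqPot {d : ℕ} (δ ω : Measure (Euc d)) (y : Euc d) : Prop :=
  ∫ x, fundSol (x - y) ∂δ = ∫ x, fundSol (x - y) ∂ω

theorem Separated.integral_eq_of_eqOn {d : ℕ} {S : Set (Euc d)} {δ ω : Measure (Euc d)}
    {a b : Euc d → Euc d} {ρ : ℝ} (h : Separated a b ρ S) (hS : IsCompact S)
    {t : ℝ} (ht : |t| < ρ) (heq : EqOn (fun t => ∫ x in S, cfund (a x) (b x) t ∂δ)
      (fun t => ∫ x in S, cfund (a x) (b x) t ∂ω) (ball 0 ρ)) :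
    ∫ x in S, fundSol (a x + t • b x) ∂δ = ∫ x in S, fundSol (a x + t • b x) ∂ω := by
  have := heq (x := (t : ℂ)) (by simpa using ht)
  simp only [h.integral_ofReal hS _ ht] at this
  exact_mod_cast this

section Potential

variable {d : ℕ} {O S : Set (Euc d)} {δ ω : Measure (Euc d)} [IsFiniteMeasure δ]
  [IsFiniteMeasure ω] {a b : Euc d → Euc d} {ρ : ℝ}

theorem Separated.eqOn_of_coeffFn (h : Separated a b ρ S) (ha : Continuous a) (hb : Continuous b)
    (hρ : 0 < ρ) (hS : IsCompact S)
    (hc : ∀ n, ∫ x in S, coeffFn a b n x ∂δ = ∫ x in S, coeffFn a b n x ∂ω) :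
    EqOn (fun t => ∫ x in S, cfund (a x) (b x) t ∂δ)
      (fun t => ∫ x in S, cfund (a x) (b x) t ∂ω) (ball 0 ρ) := by
  intro t ht
  have h1 := Complex.hasSum_taylorSeries_on_ball
    (h.differentiableOn_integral ha hb hS δ) ht
  have h2 := Complex.hasSum_taylorSeries_on_ball
    (h.differentiableOn_integral ha hb hS ω) ht
  simp only [← h.integral_coeffFn ha hb hρ hS] at h1 h2
  simp only [hc] at h1
  exact h1.unique h2

theorem integral_coeffFn_eq (hS : IsCompact S) (hSO : S ⊆ O)
    (hδ : δ.restrict S = δ) (hω : ω.restrict S = ω)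
    (hbal : ∀ h : Euc d → ℝ, HarmOn h O → ∫ x, h x ∂δ = ∫ x, h x ∂ω) {n : ℕ}
    (hc : ContinuousOn (coeffFn a b n) O ∧ HarmOn (fun x => (coeffFn a b n x).re) O ∧
      HarmOn (fun x => (coeffFn a b n x).im) O) :
    ∫ x in S, coeffFn a b n x ∂δ = ∫ x in S, coeffFn a b n x ∂ω := by
  obtain ⟨h0, h1, h2⟩ := hc
  have hintg : ∀ μ : Measure (Euc d), IsFiniteMeasure μ → μ.restrict S = μ →
      Integrable (coeffFn a b n) μ := by
    intro μ hμ hμS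
    rw [← hμS]
    exact (h0.mono hSO).integrableOn_compact hS
  rw [hδ, hω]
  apply Complex.ext
  · have e1 := Complex.reCLM.integral_comp_comm (hintg δ ‹_› hδ)
    have e2 := Complex.reCLM.integral_comp_comm (hintg ω ‹_› hω)
    simp only [Complex.reCLM_apply] at e1 e2
    rw [← e1, ← e2, hbal _ h1]
  · have e1 := Complex.imCLM.integral_comp_comm (hintg δ ‹_› hδ)
    have e2 := Complex.imCLM.integral_comp_comm (hintg ω ‹_› hω)
    simp only [Complex.imCLM_apply] at e1 e2
    rw [← e1, ← e2, hbal _ h2]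

theorem separated_sub {y v : Euc d} {ε : ℝ} (hε : 0 < ε) (hy : Disjoint (ball y ε) S)
    (hv : ‖v‖ < ε / 5) : Separated (fun x => x - y) (fun _ => -v) (5 / 4) S := by
  intro x hx
  have h1 : ε ≤ ‖x - y‖ := by
    by_contra! h
    exact Set.disjoint_left.1 hy (by rwa [mem_ball, dist_eq_norm]) hx
  refine ⟨fun h0 => ?_, ?_⟩
  · replace h0 : x - y = 0 := h0
    rw [h0, norm_zero] at h1
    linarith
  · rw [norm_neg]
    linarith

theorem eqPot_of_notMem (hO : IsOpen O) (hS : IsCompact S) (hSO : S ⊆ O)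
    (hδ : δ.restrict S = δ) (hω : ω.restrict S = ω)
    (hbal : ∀ h : Euc d → ℝ, HarmOn h O → ∫ x, h x ∂δ = ∫ x, h x ∂ω) {y v : Euc d} (hy : y ∉ O)
    {ε : ℝ} (hε : 0 < ε) (hyS : Disjoint (ball y ε) S) (hv : ‖v‖ < ε / 5) :
    EqPot δ ω (y + v) := by
  have ha : Continuous fun x : Euc d => x - y := by fun_prop
  have hb : Continuous fun _ : Euc d => -v := continuous_const
  have hsep := separated_sub hε hyS hv
  have hharm := harmOn_coeffFn ha hb hO (fun x r hr hxr => by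
    have hm : 0 < ‖x - y‖ - r := by
      have : y ∉ closedBall x r := fun h => hy (hxr h)
      rw [mem_closedBall, not_le, dist_comm, dist_eq_norm] at this
      linarith
    have hv0 := norm_nonneg v
    have hq : 4 * ((‖x - y‖ - r) / (4 * ‖v‖ + 1)) * ‖v‖ ≤ ‖x - y‖ - r := by
      rw [mul_div_assoc', div_mul_eq_mul_div, div_le_iff₀ (by positivity)]
      nlinarith
    refine ⟨(‖x - y‖ - r) / (4 * ‖v‖ + 1), by positivity, ?_, ?_⟩
    · intro z hz
      have h1 : ‖x - y‖ - r ≤ ‖z - y‖ := by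
        rw [mem_closedBall, dist_comm, dist_eq_norm] at hz
        have := norm_add_le (x - z) (z - y)
        rw [sub_add_sub_cancel] at this
        linarith
      refine ⟨fun h0 => ?_, ?_⟩
      · replace h0 : z - y = 0 := h0
        rw [h0, norm_zero] at h1
        linarith
      · rw [norm_neg]
        linarith
    · intro t ht
      have := setIntegral_fundSol_affine 1 1 (-(y + t • v)) x hr (by
        have e : (1 : ℝ) • -(y + t • v) + (1 : ℝ) • x = (x - y) - t • v := by module
        rw [e, abs_one, one_mul]
        have h2 := norm_sub_norm_le (x - y) (t • v)
        rw [norm_smul, Real.norm_eq_abs] at h2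
        have h3 : |t| * ‖v‖ ≤ (‖x - y‖ - r) / (4 * ‖v‖ + 1) * ‖v‖ := by gcongr
        linarith)
      have e : ∀ z : Euc d, (1 : ℝ) • -(y + t • v) + (1 : ℝ) • z = (z - y) + t • -v := fun z => by
        module
      simpa only [e] using this)
  have heq := hsep.eqOn_of_coeffFn (δ := δ) (ω := ω) ha hb (by norm_num) hS
    fun n => integral_coeffFn_eq hS hSO hδ hω hbal (hharm n)
  have := hsep.integral_eq_of_eqOn hS (t := 1) (by norm_num) heq
  rw [hδ, hω] at this
  have e : ∀ x : Euc d, (x - y) + (1 : ℝ) • -v = x - (y + v) := fun x => by module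
  simp only [e] at this
  exact this

theorem eqPot_of_large_norm (hO : IsOpen O) (hS : IsCompact S) (hSO : S ⊆ O)
    (hδ : δ.restrict S = δ) (hω : ω.restrict S = ω)
    (hbal : ∀ h : Euc d → ℝ, HarmOn h O → ∫ x, h x ∂δ = ∫ x, h x ∂ω) {R : ℝ} (hR : 0 ≤ R)
    (hSR : S ⊆ closedBall 0 R) {y : Euc d} (hy : 5 * R < ‖y‖) : EqPot δ ω y := by
  have ha : Continuous fun _ : Euc d => -y := continuous_const
  have hb : Continuous fun x : Euc d => x := continuous_id
  have hy0 : 0 < ‖y‖ := by linarith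
  have hy1 : -y ≠ 0 := by simpa using norm_pos_iff.1 hy0
  have hsep : Separated (fun _ => -y) (fun x => x) (5 / 4) S := by
    intro x hx
    refine ⟨hy1, ?_⟩
    have := hSR hx
    rw [mem_closedBall_zero_iff] at this
    rw [norm_neg]
    linarith
  have hharm := harmOn_coeffFn ha hb hO (fun x r hr hxr => by
    have hx0 := norm_nonneg x
    have hq : 4 * (‖y‖ / (4 * (‖x‖ + r) + 1)) * (‖x‖ + r) ≤ ‖y‖ := by
      rw [mul_div_assoc', div_mul_eq_mul_div, div_le_iff₀ (by positivity)]
      nlinarith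
    refine ⟨‖y‖ / (4 * (‖x‖ + r) + 1), by positivity, ?_, ?_⟩
    · intro z hz
      refine ⟨hy1, ?_⟩
      have h1 : ‖z‖ ≤ ‖x‖ + r := norm_le_of_mem_closedBall hz
      rw [norm_neg]
      refine le_trans ?_ hq
      gcongr
    · intro t ht
      have := setIntegral_fundSol_affine 1 t (-y) x hr (by
        have h2 := norm_sub_norm_le y (t • x)
        rw [norm_smul, Real.norm_eq_abs] at h2
        have h3 : |t| * (‖x‖ + r) ≤ ‖y‖ / (4 * (‖x‖ + r) + 1) * (‖x‖ + r) := by gcongr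
        have e : ‖(1 : ℝ) • -y + t • x‖ = ‖y - t • x‖ := by
          rw [one_smul, ← norm_neg]
          congr 1
          module
        rw [e]
        linarith)
      simpa only [one_smul] using this)
  have heq := hsep.eqOn_of_coeffFn (δ := δ) (ω := ω) ha hb (by norm_num) hS
    fun n => integral_coeffFn_eq hS hSO hδ hω hbal (hharm n)
  have := hsep.integral_eq_of_eqOn hS (t := 1) (by norm_num) heq
  rw [hδ, hω] at this
  have e : ∀ x : Euc d, -y + (1 : ℝ) • x = x - y := fun x => by module
  simp only [e] at this
  exact this

theorem eqPot_of_eventually (hS : IsCompact S)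
    (hδ : δ.restrict S = δ) (hω : ω.restrict S = ω) {y v : Euc d}
    (hy : ∀ᶠ z in 𝓝 y, EqPot δ ω z)
    {ε : ℝ} (hε : 0 < ε) (hyS : Disjoint (ball y ε) S) (hv : ‖v‖ < ε / 5) :
    EqPot δ ω (y + v) := by
  have ha : Continuous fun x : Euc d => x - y := by fun_prop
  have hb : Continuous fun _ : Euc d => -v := continuous_const
  have hsep := separated_sub hε hyS hv
  have e : ∀ (t : ℝ) (x : Euc d), (x - y) + t • -v = x - (y + t • v) := fun t x => by module
  have hev : ∀ᶠ t : ℝ in 𝓝 0, EqPot δ ω (y + t • v) := by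
    have : Tendsto (fun t : ℝ => y + t • v) (𝓝 0) (𝓝 y) := by
      have : Continuous fun t : ℝ => y + t • v := by fun_prop
      simpa using this.tendsto 0
    exact this hy
  obtain ⟨η, hη, hη'⟩ := Metric.eventually_nhds_iff.1 hev
  have heq := eqOn_ball_of_eq_ofReal (by norm_num) (hsep.differentiableOn_integral ha hb hS δ)
    (hsep.differentiableOn_integral ha hb hS ω) (lt_min hη (by norm_num : (0 : ℝ) < 5 / 4))
    (fun t ht => by
      rw [lt_min_iff] at ht
      rw [hsep.integral_ofReal hS _ ht.2, hsep.integral_ofReal hS _ ht.2, hδ, hω]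
      simp only [e]
      have := hη' (y := t) (by simpa using ht.1)
      rw [EqPot] at this
      rw [this])
  have := hsep.integral_eq_of_eqOn hS (t := 1) (by norm_num) heq
  rw [hδ, hω] at this
  simp only [e] at this
  simp only [one_smul] at this
  exact this

theorem eqPot_of_preconnected (hS : IsCompact S)
    (hδ : δ.restrict S = δ) (hω : ω.restrict S = ω) {C : Set (Euc d)} (hC : IsPreconnected C)
    (hCS : C ⊆ Sᶜ) {y : Euc d} (hyC : y ∈ C) (hy : ∀ᶠ z in 𝓝 y, EqPot δ ω z) :
    ∀ z ∈ C, EqPot δ ω z := by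
  have hsub : C ⊆ {y | ∀ᶠ z in 𝓝 y, EqPot δ ω z} := by
    apply hC.subset_of_closure_inter_subset isOpen_setOfPred_eventually_nhds ⟨y, hyC, hy⟩
    rintro z ⟨hz, hzC⟩
    obtain ⟨ε, hε, hεS⟩ := Metric.isOpen_iff.1 hS.isClosed.isOpen_compl z (hCS hzC)
    obtain ⟨w, hw, hwz⟩ := Metric.mem_closure_iff.1 hz (ε / 20) (by linarith)
    have hdis : Disjoint (ball w (ε / 2)) S := by
      rw [Set.disjoint_left]
      intro p hp hpS
      refine hεS ?_ hpS
      rw [mem_ball] at hp ⊢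
      have := dist_triangle p w z
      rw [dist_comm w z] at this
      linarith
    have : ball w (ε / 10) ∈ 𝓝 z := isOpen_ball.mem_nhds (by rw [mem_ball]; linarith)
    filter_upwards [this] with p hp
    have := eqPot_of_eventually hS hδ hω (v := p - w) hw (by linarith) hdis
      (by rw [mem_ball, dist_eq_norm] at hp; linarith)
    rwa [add_sub_cancel] at this
  intro z hz
  exact (hsub hz).self_of_nhds

end Potential

section Infill

variable {d : ℕ} {O S : Set (Euc d)}

theorem subset_connectedComponentIn_of_closure_subset (hO : IsOpen O)
    (hS : IsClosed S) {x : Euc d} (hcl : closure (connectedComponentIn (O \ S) x) ⊆ O)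
    {P : Set (Euc d)} (hP : IsPreconnected P) (hPS : P ⊆ Sᶜ)
    (hne : (P ∩ connectedComponentIn (O \ S) x).Nonempty) :
    P ⊆ connectedComponentIn (O \ S) x := by
  apply hP.subset_of_closure_inter_subset (hO.sdiff hS).connectedComponentIn hne
  rintro z ⟨hz, hzP⟩
  obtain ⟨p, hpP, hp⟩ := hne
  have h1 : IsPreconnected (insert z (connectedComponentIn (O \ S) x)) :=
    isPreconnected_connectedComponentIn.subset_closure (subset_insert _ _)
      (insert_subset hz subset_closure)
  have h2 : insert z (connectedComponentIn (O \ S) x) ⊆ O \ S :=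
    insert_subset ⟨hcl hz, hPS hzP⟩ (connectedComponentIn_subset _ _)
  rw [connectedComponentIn_eq hp]
  exact h1.subset_connectedComponentIn (mem_insert_of_mem _ hp) h2 (mem_insert _ _)

theorem isClosed_infill (hO : IsOpen O) (hS : IsClosed S) : IsClosed (infill O S) := by
  rw [← isOpen_compl_iff, Metric.isOpen_iff]
  intro y hy
  have hyS : y ∈ Sᶜ := fun h => hy (Or.inl h)
  obtain ⟨ε, hε, hb⟩ := Metric.isOpen_iff.1 hS.isOpen_compl y hyS
  refine ⟨ε, hε, fun z hz hzI => ?_⟩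
  rcases hzI with hzS | ⟨x, hx, hzC, hK, hcl⟩
  · exact hb hz hzS
  · have := subset_connectedComponentIn_of_closure_subset hO hS hcl
      (convex_ball y ε).isPreconnected hb ⟨z, hz, hzC⟩
    exact hy (Or.inr ⟨x, hx, this (mem_ball_self hε), hK, hcl⟩)

theorem infill_subset_closedBall (hO : IsOpen O) (hS : IsClosed S) {R : ℝ} (hR : 0 < R)
    (hSR : S ⊆ closedBall 0 R) : infill O S ⊆ closedBall 0 R := by
  rintro y (hyS | ⟨x, hx, hyC, hK, hcl⟩)
  · exact hSR hyS
  · by_contra hy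
    rw [mem_closedBall_zero_iff, not_le] at hy
    set P : Set (Euc d) := (fun t : ℝ => t • y) '' Ici 1 with hP
    have hPc : IsPreconnected P := isPreconnected_Ici.image _ (by fun_prop)
    have hPS : P ⊆ Sᶜ := by
      rintro _ ⟨t, ht, rfl⟩ h
      have := hSR h
      rw [mem_closedBall_zero_iff, norm_smul, Real.norm_eq_abs] at this
      have ht1 : (1 : ℝ) ≤ t := ht
      rw [abs_of_pos (by linarith)] at this
      nlinarith
    have hsub := subset_connectedComponentIn_of_closure_subset hO hS hcl hPc hPS
      ⟨y, ⟨1, self_mem_Ici, one_smul _ _⟩, hyC⟩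
    obtain ⟨M, hM⟩ := hK.isBounded.exists_norm_le
    have h1 : max 1 ((M + 1) / ‖y‖) • y ∈ P := ⟨_, mem_Ici.2 (le_max_left _ _), rfl⟩
    have h2 := hM _ (subset_closure (hsub h1))
    have hy0 : 0 < ‖y‖ := by linarith
    rw [norm_smul, Real.norm_eq_abs, abs_of_pos (by positivity)] at h2
    have h3 : (M + 1) / ‖y‖ * ‖y‖ ≤ max 1 ((M + 1) / ‖y‖) * ‖y‖ := by
      gcongr
      exact le_max_right _ _
    rw [div_mul_cancel₀ _ hy0.ne'] at h3
    linarith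

theorem isCompact_infill (hO : IsOpen O) (hS : IsCompact S) : IsCompact (infill O S) := by
  obtain ⟨R, hR, hSR⟩ := hS.isBounded.subset_closedBall_lt 0 0
  exact (isCompact_closedBall (0 : Euc d) R).of_isClosed_subset (isClosed_infill hO hS.isClosed)
    (infill_subset_closedBall hO hS.isClosed hR hSR)

/-- The potentials of a measure and of its harmonic balayage agree off the inward filling. -/
theorem eqPot_of_notMem_infill {δ ω : Measure (Euc d)} [IsFiniteMeasure δ] [IsFiniteMeasure ω]
    (hO : IsOpen O) (hS : IsCompact S) (hSO : S ⊆ O)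
    (hδ : δ.restrict S = δ) (hω : ω.restrict S = ω)
    (hbal : ∀ h : Euc d → ℝ, HarmOn h O → ∫ x, h x ∂δ = ∫ x, h x ∂ω) {y : Euc d}
    (hy : y ∉ infill O S) : EqPot δ ω y := by
  have hyS : y ∈ Sᶜ := fun h => hy (Or.inl h)
  have hoff : ∀ z ∉ O, ∀ᶠ p in 𝓝 z, EqPot δ ω p := by
    intro z hz
    obtain ⟨ε, hε, hb⟩ := Metric.isOpen_iff.1 hS.isClosed.isOpen_compl z fun h => hz (hSO h)
    filter_upwards [ball_mem_nhds z (by positivity : 0 < ε / 5)] with p hp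
    have := eqPot_of_notMem hO hS hSO hδ hω hbal hz hε
      (disjoint_left.2 fun _ h => hb h) (v := p - z) (by rwa [mem_ball, dist_eq_norm] at hp)
    rwa [add_sub_cancel] at this
  by_cases hyO : y ∈ O
  · set C := connectedComponentIn (O \ S) y with hC
    have hyC : y ∈ C := mem_connectedComponentIn ⟨hyO, hyS⟩
    have hCS : C ⊆ Sᶜ := fun z hz => (connectedComponentIn_subset _ _ hz).2
    suffices ∃ p ∈ C, ∀ᶠ z in 𝓝 p, EqPot δ ω z by
      obtain ⟨p, hp, hp'⟩ := this
      exact eqPot_of_preconnected hS hδ hω isPreconnected_connectedComponentIn hCS hp hp' y hyC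
    by_cases hcl : closure C ⊆ O
    · have hncomp : ¬ IsCompact (closure C) := fun h => hy (Or.inr ⟨y, ⟨hyO, hyS⟩, hyC, h, hcl⟩)
      obtain ⟨R, hR, hSR⟩ := hS.isBounded.subset_closedBall_lt 0 0
      obtain ⟨p, hpC, hp⟩ : ∃ p ∈ C, 5 * R < ‖p‖ := by
        by_contra! hall
        apply hncomp
        apply Bornology.IsBounded.isCompact_closure
        exact isBounded_closedBall.subset fun p hp => mem_closedBall_zero_iff.2 (hall p hp)
      refine ⟨p, hpC, ?_⟩
      filter_upwards [(isOpen_lt continuous_const continuous_norm).mem_nhds hp] with z hz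
      exact eqPot_of_large_norm hO hS hSO hδ hω hbal hR.le hSR hz
    · obtain ⟨z, hz, hzO⟩ := not_subset.1 hcl
      have h1 := eventually_eventually_nhds.2 (hoff z hzO)
      obtain ⟨p, hp, hpC⟩ := (mem_closure_iff_nhds.1 hz) _ h1
      exact ⟨p, hpC, hp⟩
  · exact (hoff y hyO).self_of_nhds

end Infill

/-- The fundamental solution, truncated on the ball of radius `r`. -/
def truncSol {d : ℕ} (r : ℝ) (x : Euc d) : ℝ := kernR d (max (‖x‖ ^ 2) (r ^ 2))

/-- The defect in the mean value property of the truncated fundamental solution. -/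
def defect {d : ℕ} (r s : ℝ) (x : Euc d) : ℝ :=
  ∫ z in closedBall (0 : Euc d) 1, (truncSol r (x + s • z) - truncSol r x)

section Truncated

variable {d : ℕ} {r s : ℝ} {x y : Euc d}

theorem continuous_truncSol (hr : 0 < r) : Continuous (truncSol (d := d) r) := by
  refine (continuousOn_kernR d).comp_continuous (by fun_prop) fun x => ?_
  exact mem_Ioi.2 (lt_max_of_lt_right (by positivity))

theorem truncSol_of_le (hr : 0 < r) (hx : r ≤ ‖x‖) : truncSol r x = fundSol x := by
  rw [truncSol, fundSol, max_eq_left (by gcongr)]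

theorem truncSol_of_norm_le (hx : ‖x‖ ≤ r) : truncSol r x = kernR d (r ^ 2) := by
  rw [truncSol, max_eq_right (by gcongr)]

theorem kernR_le_truncSol (hr : 0 < r) (x : Euc d) : kernR d (r ^ 2) ≤ truncSol r x :=
  (strictMonoOn_kernR d).monotoneOn (mem_Ioi.2 (by positivity))
    (mem_Ioi.2 (lt_max_of_lt_right (by positivity))) (le_max_right _ _)

theorem fundSol_le_truncSol (hr : 0 < r) (hx : x ≠ 0) : fundSol x ≤ truncSol r x :=
  (strictMonoOn_kernR d).monotoneOn (mem_Ioi.2 (by positivity))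
    (mem_Ioi.2 (lt_max_of_lt_right (by positivity))) (le_max_left _ _)

theorem kernR_lt_truncSol (hr : 0 < r) (hx : r < ‖x‖) : kernR d (r ^ 2) < truncSol r x :=
  strictMonoOn_kernR d (mem_Ioi.2 (by positivity))
    (mem_Ioi.2 (lt_max_of_lt_right (by positivity))) (lt_max_of_lt_left (by gcongr))

theorem continuous_truncSol_sub (hr : 0 < r) (s : ℝ) :
    Continuous fun p : Euc d × Euc d => truncSol r (p.1 + s • p.2) - truncSol r p.1 := by
  have := continuous_truncSol (d := d) hr
  fun_prop

theorem integrableOn_unitBall {f : Euc d → ℝ} (hf : Continuous f) :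
    IntegrableOn f (closedBall 0 1) :=
  hf.continuousOn.integrableOn_compact (isCompact_closedBall _ _)

theorem continuous_defect (hr : 0 < r) : Continuous (defect (d := d) r s) := by
  have h := continuous_parametric_integral_of_continuous
    (μ := (volume : Measure (Euc d))) (s := closedBall (0 : Euc d) 1)
    (f := fun x z => truncSol r (x + s • z) - truncSol r x)
    (continuous_truncSol_sub hr s) (isCompact_closedBall _ _)
  exact h

theorem defect_eq (hr : 0 < r) :
    defect r s x = (∫ z in closedBall (0 : Euc d) 1, truncSol r (x + s • z)) -
      volume.real (closedBall (0 : Euc d) 1) * truncSol r x := by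
  have := continuous_truncSol (d := d) hr
  rw [defect, integral_sub (integrableOn_unitBall (by fun_prop))
    (integrableOn_unitBall (by fun_prop))]
  simp

theorem defect_eq_zero (hr : 0 < r) (hs : 0 < s) (hx : r + s < ‖x‖) : defect r s x = 0 := by
  rw [defect_eq hr, truncSol_of_le hr (by linarith),
    ← integral_fundSol x s (by rw [abs_of_pos hs]; linarith), sub_eq_zero]
  refine setIntegral_congr_fun isClosed_closedBall.measurableSet fun z hz => ?_
  rw [mem_closedBall_zero_iff] at hz
  apply truncSol_of_le hr
  have h1 := norm_sub_le (x + s • z) (s • z)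
  rw [add_sub_cancel_right, norm_smul, Real.norm_eq_abs, abs_of_pos hs] at h1
  nlinarith

theorem defect_nonneg (hr : 0 < r) (hs : 0 < s) (hsr : s < r) (x : Euc d) :
    0 ≤ defect r s x := by
  rcases le_or_gt ‖x‖ r with hx | hx
  · apply integral_nonneg
    intro z
    simp only [Pi.zero_apply, sub_nonneg, truncSol_of_norm_le hx]
    exact kernR_le_truncSol hr _
  · have hne : ∀ z ∈ closedBall (0 : Euc d) 1, x + s • z ≠ 0 := by
      intro z hz
      rw [mem_closedBall_zero_iff] at hz
      apply add_smul_ne_zero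
      rw [abs_of_pos hs]
      nlinarith
    have hc := continuous_truncSol (d := d) hr
    rw [defect_eq hr, truncSol_of_le hr hx.le,
      ← integral_fundSol x s (by rw [abs_of_pos hs]; linarith), sub_nonneg]
    refine setIntegral_mono_on ?_ (integrableOn_unitBall (by fun_prop))
      isClosed_closedBall.measurableSet fun z hz => fundSol_le_truncSol hr (hne z hz)
    apply ContinuousOn.integrableOn_compact (isCompact_closedBall _ _)
    intro z hz
    exact (ContinuousAt.comp (f := fun z : Euc d => x + s • z)
      (continuousAt_fundSol (hne z hz)) (by fun_prop)).continuousWithinAt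

theorem defect_pos (hr : 0 < r) (hs : 0 < s) (hx : ‖x‖ = r) : 0 < defect r s x := by
  have hcont : Continuous fun z => truncSol r (x + s • z) - truncSol r x := by
    have := continuous_truncSol (d := d) hr
    fun_prop
  have hnn : ∀ z, 0 ≤ truncSol r (x + s • z) - truncSol r x := fun z => by
    rw [sub_nonneg, truncSol_of_norm_le hx.le]
    exact kernR_le_truncSol hr _
  rw [defect, integral_pos_iff_support_of_nonneg hnn (integrableOn_unitBall hcont)]
  have hopen : IsOpen (Function.support fun z => truncSol r (x + s • z) - truncSol r x) :=
    hcont.isOpen_support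
  rw [Measure.restrict_apply hopen.measurableSet]
  refine lt_of_lt_of_le ?_ (measure_mono (inter_subset_inter_right _ ball_subset_closedBall))
  refine (hopen.inter isOpen_ball).measure_pos volume ?_
  refine ⟨(1 / (2 * r)) • x, ?_, ?_⟩
  · rw [Function.mem_support]
    apply ne_of_gt
    rw [sub_pos, truncSol_of_norm_le hx.le]
    apply kernR_lt_truncSol hr
    have e : x + s • (1 / (2 * r)) • x = (1 + s * (1 / (2 * r))) • x := by module
    rw [e, norm_smul, Real.norm_eq_abs, hx, abs_of_pos (by positivity)]
    have : 0 < s * (1 / (2 * r)) := by positivity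
    nlinarith
  · rw [mem_ball_zero_iff, norm_smul, hx, Real.norm_eq_abs, abs_of_pos (by positivity)]
    field_simp
    norm_num

theorem defect_congr_norm (h : ‖x‖ = ‖y‖) : defect r s x = defect r s y := by
  set g : Euc d ≃ₗᵢ[ℝ] Euc d := (Submodule.span ℝ {x - y})ᗮ.reflection
  have hg : g x = y := Submodule.reflection_sub h
  have hE : ∀ z, truncSol r (g z) = truncSol r z := fun z => by
    rw [truncSol, truncSol, g.norm_map]
  have := g.measurePreserving.setIntegral_preimage_emb g.toHomeomorph.measurableEmbedding
    (fun z => truncSol r (y + s • z) - truncSol r y) (closedBall 0 1)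
  rw [defect, defect, ← this]
  have hpre : g ⁻¹' closedBall 0 1 = closedBall (0 : Euc d) 1 := by
    ext z
    simp
  rw [hpre]
  congr 1
  ext z
  rw [← hE x, ← hE (x + s • z), map_add, map_smul, hg]

theorem hasCompactSupport_defect (hr : 0 < r) (hs : 0 < s) :
    HasCompactSupport (defect (d := d) r s) :=
  HasCompactSupport.intro (isCompact_closedBall 0 (r + s)) fun _ hx =>
    defect_eq_zero hr hs (by simpa using hx)

theorem integral_defect_pos (hd : 0 < d) (hr : 0 < r) (hs : 0 < s) (hsr : s < r) :
    0 < ∫ x : Euc d, defect r s x := by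
  apply (continuous_defect hr).integral_pos_of_hasCompactSupport_nonneg_nonzero
    (hasCompactSupport_defect hr hs) (defect_nonneg hr hs hsr)
    (x := EuclideanSpace.single ⟨0, hd⟩ r)
  apply ne_of_gt
  apply defect_pos hr hs
  simp [abs_of_pos hr]

end Truncated

/-- Mean value property with a radial weight. -/
theorem HarmOn.integral_radial {d : ℕ} (hd : 0 < d) {h : Euc d → ℝ} {V : Set (Euc d)}
    (hh : HarmOn h V) {x : Euc d} {ρ : ℝ} (hρ : 0 < ρ) (hx : closedBall x ρ ⊆ V) {w : Euc d → ℝ}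
    (hw : Continuous w) (hrad : ∀ y z, ‖y‖ = ‖z‖ → w y = w z) :
    ∫ z in closedBall (0 : Euc d) ρ, w z * h (x + z) =
      h x * ∫ z in closedBall (0 : Euc d) ρ, w z := by
  set B := closedBall (0 : Euc d) ρ with hB
  have hBm : MeasurableSet B := isClosed_closedBall.measurableSet
  have hBc : IsCompact B := isCompact_closedBall _ _
  have hmaps : MapsTo (fun z => x + z) B V := fun z hz => hx (by
    rw [hB, mem_closedBall_zero_iff] at hz
    simpa [mem_closedBall, dist_eq_norm] using hz)
  have hF : ContinuousOn (fun z => h (x + z)) B := hh.1.comp (by fun_prop) hmaps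
  obtain ⟨M, hM⟩ := hBc.exists_bound_of_continuousOn hF
  have hM' : ∀ z ∈ B, 0 ≤ h (x + z) + M := fun z hz => by
    have := neg_le_of_abs_le (hM z hz)
    linarith
  have h0B : (0 : Euc d) ∈ B := mem_closedBall_self hρ.le
  have hx0 : 0 ≤ h x + M := by simpa using hM' 0 h0B
  set ν : Measure (Euc d) := volume.restrict B with hν
  have hFm : AEMeasurable (fun z => h (x + z) + M) ν :=
    (hF.aemeasurable hBm).add_const M
  set w' : ℝ → ℝ := fun t => w (t • EuclideanSpace.single ⟨0, hd⟩ 1)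
  have hw' : ∀ z, w' ‖z‖ = w z := fun z => hrad _ _ (by simp [norm_smul])
  have hw'c : Continuous w' := by fun_prop
  have hfin : ∀ f : Euc d → ℝ, ContinuousOn f B →
      IsFiniteMeasure (ν.withDensity fun z => ENNReal.ofReal (f z)) := fun f hf => by
    exact isFiniteMeasure_withDensity_ofReal (hf.integrableOn_compact hBc).2
  have hball : ∀ t, 0 < t → t ≤ ρ → ∫⁻ z in closedBall 0 t, ENNReal.ofReal (h (x + z) + M) =
      ∫⁻ _ in closedBall (0 : Euc d) t, ENNReal.ofReal (h x + M) := by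
    intro t ht htρ
    have hsub : closedBall (0 : Euc d) t ⊆ B := closedBall_subset_closedBall htρ
    have hm : MeasurableSet (closedBall (0 : Euc d) t) := isClosed_closedBall.measurableSet
    have hi : IntegrableOn (fun z => h (x + z)) (closedBall 0 t) :=
      (hF.mono hsub).integrableOn_compact (isCompact_closedBall _ _)
    have hic : ∀ c : ℝ, IntegrableOn (fun _ => c) (closedBall (0 : Euc d) t) := fun c =>
      integrableOn_const measure_closedBall_lt_top.ne
    have hiM : IntegrableOn (fun z => h (x + z) + M) (closedBall 0 t) := hi.add (hic M)
    rw [← ofReal_integral_eq_lintegral_ofReal hiM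
        ((ae_restrict_mem hm).mono fun z hz => hM' z (hsub hz)),
      ← ofReal_integral_eq_lintegral_ofReal (hic _) (ae_of_all _ fun _ => hx0)]
    congr 1
    have h1 := setIntegral_closedBall_eq (fun z => h (x + z)) 0 ht
    simp only [zero_add] at h1
    have h2 := hh.integral_unitBall ht ((closedBall_subset_closedBall htρ).trans hx)
    rw [h2] at h1
    have h3 := volume_real_closedBall (0 : Euc d) ht
    rw [integral_add hi (hic M), h1, setIntegral_const, setIntegral_const, h3]
    simp only [smul_eq_mul]
    ring
  have hmap : (ν.withDensity fun z => ENNReal.ofReal (h (x + z) + M)).map norm =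
      (ν.withDensity fun _ => ENNReal.ofReal (h x + M)).map norm := by
    have := hfin (fun z => h (x + z) + M) (hF.add continuousOn_const)
    apply Measure.ext_of_Iic
    intro a
    have hpre : norm ⁻¹' Iic a = closedBall (0 : Euc d) a := by
      ext z
      simp
    have hm : MeasurableSet (closedBall (0 : Euc d) a) := isClosed_closedBall.measurableSet
    rw [Measure.map_apply measurable_norm measurableSet_Iic,
      Measure.map_apply measurable_norm measurableSet_Iic, hpre, withDensity_apply _ hm,
      withDensity_apply _ hm]
    rcases le_or_gt a 0 with ha | ha
    · refine setLIntegral_congr_fun hm fun z hz => ?_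
      rw [mem_closedBall_zero_iff] at hz
      have : z = 0 := norm_le_zero_iff.1 (hz.trans ha)
      simp [this]
    · have hintg : closedBall (0 : Euc d) a ∩ B = closedBall 0 (min a ρ) := by
        ext z
        simp [hB]
      rw [hν, Measure.restrict_restrict hm, hintg]
      exact hball _ (lt_min ha hρ) (min_le_right _ _)
  have hlt : ∀ f : Euc d → ℝ, ∀ᵐ z ∂ν, ENNReal.ofReal (f z) < ⊤ := fun f =>
    ae_of_all _ fun _ => ENNReal.ofReal_lt_top
  have e1 := integral_withDensity_eq_integral_toReal_smul₀ hFm.ennreal_ofReal (hlt _) w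
  have e2 := integral_withDensity_eq_integral_toReal_smul₀
    (aemeasurable_const (μ := ν) (b := ENNReal.ofReal (h x + M))) (hlt fun _ => h x + M) w
  have e3 : ∀ μ : Measure (Euc d), ∫ z, w z ∂μ = ∫ t, w' t ∂(μ.map norm) := fun μ => by
    rw [integral_map measurable_norm.aemeasurable hw'c.aestronglyMeasurable]
    simp only [hw']
  rw [e3, hmap, ← e3, e2] at e1
  have hwi : Integrable w ν := hw.continuousOn.integrableOn_compact hBc
  have hwF : Integrable (fun z => w z * h (x + z)) ν :=
    (hw.continuousOn.mul hF).integrableOn_compact hBc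
  have e4 : ∫ z, (ENNReal.ofReal (h (x + z) + M)).toReal • w z ∂ν =
      ∫ z, (w z * h (x + z) + M * w z) ∂ν := by
    refine setIntegral_congr_fun hBm fun z hz => ?_
    simp only [ENNReal.toReal_ofReal (hM' z hz), smul_eq_mul]
    ring
  rw [e4, integral_add hwF (hwi.const_mul M), integral_const_mul] at e1
  simp only [ENNReal.toReal_ofReal hx0, smul_eq_mul] at e1
  rw [integral_const_mul] at e1
  linarith

/-- The integral of a function over the ball of radius `s` about `y`, in unit-ball coordinates. -/
def ballInt {d : ℕ} (s : ℝ) (g : Euc d → ℝ) (y : Euc d) : ℝ :=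
  ∫ z in closedBall (0 : Euc d) 1, g (y + s • z)

theorem integrable_prod_mul {d : ℕ} {μ : Measure (Euc d)} [IsFiniteMeasure μ] {A : Set (Euc d)}
    (hA : IsCompact A) (hμ : ∀ᵐ x ∂μ, x ∈ A) {φ γ : Euc d × Euc d → ℝ} (hφ : Continuous φ)
    (hγ : Measurable γ) {M R : ℝ} (hM : ∀ p, |γ p| ≤ M)
    (h0 : ∀ x ∈ A, ∀ y, R < ‖y‖ → γ (x, y) = 0) :
    Integrable (fun p => φ p * γ p) (μ.prod (volume : Measure (Euc d))) := by
  obtain ⟨C, hC⟩ := (hA.prod (isCompact_closedBall (0 : Euc d) R)).exists_bound_of_continuousOn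
    hφ.continuousOn
  have hbd : Integrable ((closedBall (0 : Euc d) R).indicator fun _ => C * M) volume :=
    (integrable_indicator_iff isClosed_closedBall.measurableSet).2
      (integrableOn_const measure_closedBall_lt_top.ne)
  refine (hbd.comp_snd μ).mono' (hφ.measurable.mul hγ).aestronglyMeasurable ?_
  filter_upwards [Measure.quasiMeasurePreserving_fst.ae hμ] with p hp
  by_cases hpR : p.2 ∈ closedBall (0 : Euc d) R
  · rw [indicator_of_mem hpR, norm_mul]
    have h1 := hC p ⟨hp, hpR⟩
    exact mul_le_mul h1 (hM p) (norm_nonneg _) ((norm_nonneg _).trans h1)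
  · rw [indicator_of_notMem hpR]
    rw [mem_closedBall_zero_iff, not_le] at hpR
    have : γ p = 0 := h0 p.1 hp p.2 hpR
    simp [this]

section BallInt

variable {d : ℕ} {s M R : ℝ} {f g : Euc d → ℝ}

theorem ae_mem_unitBall :
    ∀ᵐ z ∂(volume.restrict (closedBall (0 : Euc d) 1)), z ∈ closedBall (0 : Euc d) 1 :=
  ae_restrict_mem isClosed_closedBall.measurableSet

theorem setIntegral_unitBall_neg (f : Euc d → ℝ) :
    ∫ z in closedBall (0 : Euc d) 1, f (-z) = ∫ z in closedBall (0 : Euc d) 1, f z := by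
  have := (Measure.measurePreserving_neg (volume : Measure (Euc d))).setIntegral_preimage_emb
    (Homeomorph.neg _).measurableEmbedding f (closedBall 0 1)
  rw [← this]
  congr 2
  ext z
  simp

theorem continuous_ballInt (hf : Continuous f) : Continuous (ballInt s f) := by
  have := continuous_parametric_integral_of_continuous
    (μ := (volume : Measure (Euc d))) (s := closedBall (0 : Euc d) 1)
    (f := fun x z => f (x + s • z)) (by fun_prop) (isCompact_closedBall _ _)
  exact this

theorem measurable_ballInt (hg : Measurable g) : Measurable (ballInt s g) := by
  have : Measurable (Function.uncurry fun (y z : Euc d) => g (y + s • z)) :=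
    hg.comp (by fun_prop : Measurable fun p : Euc d × Euc d => p.1 + s • p.2)
  exact this.stronglyMeasurable.integral_prod_right.measurable

theorem abs_ballInt_le (hM : ∀ y, |g y| ≤ M) (y : Euc d) :
    |ballInt s g y| ≤ M * volume.real (closedBall (0 : Euc d) 1) := by
  rw [← Real.norm_eq_abs, ballInt]
  exact norm_setIntegral_le_of_norm_le_const measure_closedBall_lt_top fun _ _ => hM _

theorem add_smul_norm_gt (hs : 0 < s) {y z : Euc d} (hz : z ∈ closedBall (0 : Euc d) 1)
    (hy : R + s < ‖y‖) : R < ‖y + s • z‖ := by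
  rw [mem_closedBall_zero_iff] at hz
  have h1 := norm_sub_le (y + s • z) (s • z)
  rw [add_sub_cancel_right, norm_smul, Real.norm_eq_abs, abs_of_pos hs] at h1
  nlinarith

theorem ballInt_eq_zero (hs : 0 < s) (h0 : ∀ y, R < ‖y‖ → g y = 0) {y : Euc d}
    (hy : R + s < ‖y‖) : ballInt s g y = 0 :=
  setIntegral_eq_zero_of_forall_eq_zero fun _ hz => h0 _ (add_smul_norm_gt hs hz hy)

theorem integrable_mul_of_bounded (hf : Continuous f) (hg : Measurable g) (hM : ∀ y, |g y| ≤ M)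
    (h0 : ∀ y, R < ‖y‖ → g y = 0) : Integrable fun y => f y * g y := by
  have h1 : IntegrableOn (fun y => f y * g y) (closedBall 0 R) := by
    refine Integrable.mul_bdd (c := M)
      (hf.continuousOn.integrableOn_compact (isCompact_closedBall _ _))
      hg.aestronglyMeasurable (ae_of_all _ hM)
  refine h1.integrable_of_forall_notMem_eq_zero fun y hy => ?_
  rw [mem_closedBall_zero_iff, not_le] at hy
  rw [h0 y hy, mul_zero]

/-- Averaging over balls is symmetric. -/
theorem integral_mul_ballInt (hs : 0 < s) (hf : Continuous f) (hg : Measurable g)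
    (hM : ∀ y, |g y| ≤ M) (h0 : ∀ y, R < ‖y‖ → g y = 0) :
    ∫ y, f y * ballInt s g y = ∫ y, ballInt s f y * g y := by
  have hB : IsCompact (closedBall (0 : Euc d) 1) := isCompact_closedBall _ _
  have : IsFiniteMeasure (volume.restrict (closedBall (0 : Euc d) 1)) :=
    isFiniteMeasure_restrict.2 measure_closedBall_lt_top.ne
  have i1 := integrable_prod_mul hB ae_mem_unitBall
    (φ := fun p => f p.2) (γ := fun p => g (p.2 + s • p.1)) (by fun_prop)
    (hg.comp (by fun_prop : Measurable fun p : Euc d × Euc d => p.2 + s • p.1))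
    (fun p => hM _) (fun z hz y hy => h0 _ (add_smul_norm_gt hs hz hy))
  have i2 := integrable_prod_mul hB ae_mem_unitBall
    (φ := fun p => f (p.2 + s • p.1)) (γ := fun p => g p.2) (by fun_prop)
    (hg.comp measurable_snd) (fun p => hM _) (fun z hz y hy => h0 _ hy)
  have e1 := integral_integral_swap (f := fun z y => f y * g (y + s • z)) i1
  have e2 := integral_integral_swap (f := fun z y => f (y + s • z) * g y) i2
  simp only [integral_const_mul] at e1
  simp only [integral_mul_const] at e2
  change _ = ∫ y, f y * ballInt s g y at e1
  change _ = ∫ y, ballInt s f y * g y at e2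
  rw [← e1, ← e2, ← setIntegral_unitBall_neg]
  congr 1
  ext z
  have := integral_add_right_eq_self (μ := volume) (fun y => f y * g (y + s • -z)) (s • z)
  rw [← this]
  congr 1
  ext y
  congr 2
  module

end BallInt

/-- Two measures carried by `S ⊆ T` whose potentials agree off `T` have equal integrals of all
functions harmonic near `T`. -/
theorem integral_eq_of_eqPot {d : ℕ} (hd : 0 < d) {S T V : Set (Euc d)} (hS : IsCompact S)
    (hT : IsCompact T) (hST : S ⊆ T) (hV : IsOpen V) (hTV : T ⊆ V) {δ ω : Measure (Euc d)}
    [IsFiniteMeasure δ] [IsFiniteMeasure ω] (hδ : ∀ᵐ x ∂δ, x ∈ S) (hω : ∀ᵐ x ∂ω, x ∈ S)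
    (hpot : ∀ y ∉ T, EqPot δ ω y) {h : Euc d → ℝ} (hh : HarmOn h V) :
    ∫ x, h x ∂δ = ∫ x, h x ∂ω := by
  obtain ⟨η, hη, hηV⟩ := hT.exists_cthickening_subset_open hV hTV
  set r := η / 2 with hr'
  set s := η / 4 with hs'
  have hr : 0 < r := by positivity
  have hs : 0 < s := by positivity
  have hsr : s < r := by linarith
  set K := cthickening (s + r) T with hK
  have hKV : K ⊆ V := (cthickening_mono (by linarith) T).trans hηV
  have hKc : IsCompact K := hT.cthickening
  have hhK : ContinuousOn h K := hh.1.mono hKV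
  obtain ⟨M, hM⟩ := hKc.exists_bound_of_continuousOn hhK
  obtain ⟨R, hR, hKR⟩ := hKc.isBounded.subset_closedBall_lt 0 0
  set g := K.indicator h with hg'
  have hg : Measurable g := by
    classical
    rw [hg', ← piecewise_eq_indicator]
    exact hhK.measurable_piecewise continuousOn_const hKc.isClosed.measurableSet
  have hgM : ∀ y, |g y| ≤ |M| := fun y => by
    by_cases hy : y ∈ K
    · rw [hg', indicator_of_mem hy]
      exact (hM y hy).trans (le_abs_self M)
    · rw [hg', indicator_of_notMem hy, abs_zero]
      exact abs_nonneg M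
  have hg0 : ∀ y, R < ‖y‖ → g y = 0 := fun y hy => by
    apply indicator_of_notMem
    intro hyK
    have := hKR hyK
    rw [mem_closedBall_zero_iff] at this
    linarith
  set v := volume.real (closedBall (0 : Euc d) 1) with hv
  have hv0 : 0 < v := volume_real_unitBall_pos d
  set G : Euc d → ℝ := fun y => ballInt s g y - v * g y with hG'
  have hGm : Measurable G := (measurable_ballInt hg).sub (hg.const_mul v)
  have hGM : ∀ y, |G y| ≤ |M| * v + v * |M| := fun y => by
    refine (abs_sub _ _).trans (add_le_add (abs_ballInt_le hgM y) ?_)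
    rw [abs_mul, abs_of_pos hv0]
    exact mul_le_mul_of_nonneg_left (hgM y) hv0.le
  have hG0 : ∀ y, R + s < ‖y‖ → G y = 0 := fun y hy => by
    rw [hG']
    simp only [ballInt_eq_zero hs hg0 hy, hg0 y (by linarith), mul_zero, sub_zero]
  have hGT : ∀ y ∈ cthickening r T, G y = 0 := fun y hy => by
    have hsub : closedBall y s ⊆ K := (closedBall_subset_cthickening hy s).trans
      (cthickening_cthickening_subset hs.le hr.le T)
    have h1 := hh.integral_unitBall hs (hsub.trans hKV)
    have h2 : ballInt s g y = ∫ z in closedBall (0 : Euc d) 1, h (y + s • z) := by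
      refine setIntegral_congr_fun isClosed_closedBall.measurableSet fun z hz => ?_
      rw [mem_closedBall_zero_iff] at hz
      apply indicator_of_mem
      apply hsub
      rw [mem_closedBall, dist_eq_norm, add_sub_cancel_left, norm_smul, Real.norm_eq_abs,
        abs_of_pos hs]
      nlinarith
    simp only [hG', h2, h1]
    rw [hg', indicator_of_mem (hsub (mem_closedBall_self hs.le)), sub_self]
  have hE := continuous_truncSol (d := d) hr
  set I := ∫ x : Euc d, defect r s x with hI
  have hIpos : 0 < I := integral_defect_pos hd hr hs hsr
  have hinner : ∀ x ∈ S, ∫ y, truncSol r (y - x) * G y = h x * I := by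
    intro x hx
    have hE' : Continuous fun y => truncSol r (y - x) := by fun_prop
    have hE'' : Continuous (ballInt s fun y => truncSol r (y - x)) :=
      continuous_ballInt hE'
    have hxK : closedBall x (r + s) ⊆ K := by
      rw [hK, add_comm s r]
      exact closedBall_subset_cthickening (hST hx) _
    have i1 : Integrable fun y => truncSol r (y - x) * ballInt s g y :=
      integrable_mul_of_bounded hE' (measurable_ballInt hg) (abs_ballInt_le hgM)
        fun y hy => ballInt_eq_zero hs hg0 hy
    have i2 := integrable_mul_of_bounded hE' hg hgM hg0
    have i3 := integrable_mul_of_bounded hE'' hg hgM hg0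
    calc ∫ y, truncSol r (y - x) * G y
        = ∫ y, (truncSol r (y - x) * ballInt s g y - v * (truncSol r (y - x) * g y)) := by
          congr 1
          ext y
          simp only [hG']
          ring
      _ = ∫ y, (ballInt s (fun y => truncSol r (y - x)) y * g y -
            v * (truncSol r (y - x) * g y)) := by
          rw [integral_sub i1 (i2.const_mul v), integral_mul_ballInt hs hE' hg hgM hg0,
            integral_sub i3 (i2.const_mul v)]
      _ = ∫ y, defect r s (y - x) * g y := by
          congr 1
          ext y
          rw [defect_eq hr]
          simp only [ballInt, add_sub_right_comm]
          ring
      _ = ∫ z, defect r s z * g (x + z) := by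
          rw [← integral_add_left_eq_self _ x]
          simp only [add_sub_cancel_left]
      _ = ∫ z in closedBall 0 (r + s), defect r s z * g (x + z) := by
          refine (setIntegral_eq_integral_of_forall_compl_eq_zero fun z hz => ?_).symm
          rw [mem_closedBall_zero_iff, not_le] at hz
          rw [defect_eq_zero hr hs hz, zero_mul]
      _ = ∫ z in closedBall 0 (r + s), defect r s z * h (x + z) := by
          refine setIntegral_congr_fun isClosed_closedBall.measurableSet fun z hz => ?_
          have : x + z ∈ K := hxK (by simpa [dist_eq_norm] using hz)
          simp only [hg', indicator_of_mem this]
      _ = h x * ∫ z in closedBall 0 (r + s), defect r s z :=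
          hh.integral_radial hd (by positivity) (hxK.trans hKV) (continuous_defect hr)
            fun _ _ => defect_congr_norm
      _ = h x * I := by
          rw [setIntegral_eq_integral_of_forall_compl_eq_zero fun z hz => ?_]
          rw [mem_closedBall_zero_iff, not_le] at hz
          exact defect_eq_zero hr hs hz
  have hswap : ∀ ν : Measure (Euc d), IsFiniteMeasure ν → (∀ᵐ x ∂ν, x ∈ S) →
      (∫ x, h x ∂ν) * I = ∫ y, (∫ x, truncSol r (y - x) ∂ν) * G y := by
    intro ν _ hνS
    have i1 := integrable_prod_mul hS hνS (φ := fun p => truncSol r (p.2 - p.1))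
      (γ := fun p => G p.2) (by fun_prop) (hGm.comp measurable_snd) (fun p => hGM _)
      (fun x hx y hy => hG0 _ hy)
    have e1 := integral_integral_swap (f := fun x y => truncSol r (y - x) * G y) i1
    simp only [integral_mul_const] at e1
    rw [← e1, ← integral_mul_const]
    refine integral_congr_ae ?_
    filter_upwards [hνS] with x hx
    exact (hinner x hx).symm
  have hU : ∀ y, (∫ x, truncSol r (y - x) ∂δ) * G y = (∫ x, truncSol r (y - x) ∂ω) * G y := by
    intro y
    by_cases hy : y ∈ cthickening r T
    · rw [hGT y hy, mul_zero, mul_zero]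
    · have hyT : y ∉ T := fun h => hy (self_subset_cthickening T h)
      have hxy : ∀ x ∈ S, truncSol r (y - x) = fundSol (x - y) := fun x hx => by
        rw [truncSol_of_le hr, fundSol, fundSol, norm_sub_rev]
        by_contra! hlt
        exact hy (closedBall_subset_cthickening (hST hx) r
          (by rw [mem_closedBall, dist_eq_norm]; exact hlt.le))
      have h1 := hpot y hyT
      rw [EqPot] at h1
      rw [integral_congr_ae (hδ.mono hxy), integral_congr_ae (hω.mono hxy), h1]
  have h1 := hswap δ ‹_› hδ
  have h2 := hswap ω ‹_› hω
  simp only [hU] at h1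
  exact mul_right_cancel₀ hIpos.ne' (h1.trans h2.symm)

/-- Let `ω` be a `har(O)`-balayage of `δ` (both finite positive Borel
measures with compact support in the open set `O ⊆ ℝ^d`), and let
`S_O := infill O (supp ω ∪ supp δ)`. Then `∫ h dδ = ∫ h dω` for every function `h` harmonic
on an open neighbourhood of `S_O`; in particular, for every open `O' ⊇ S_O`, `ω` is a
`har(O')`-balayage of `δ`. -/
theorem stmt_16 {d : ℕ} (O : Set (Euc d)) (hO : IsOpen O) (hOne : O.Nonempty)
    (δ ω : Measure (Euc d)) (hδ : MeasCompIn δ O) (hω : MeasCompIn ω O)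
    (hbal : ∀ h : Euc d → ℝ, HarmOn h O → ∫ x, h x ∂δ = ∫ x, h x ∂ω) :
    (∀ h : Euc d → ℝ, ∀ V : Set (Euc d), IsOpen V →
        infill O (msupp ω ∪ msupp δ) ⊆ V → HarmOn h V → ∫ x, h x ∂δ = ∫ x, h x ∂ω) ∧
    (∀ O' : Set (Euc d), IsOpen O' → infill O (msupp ω ∪ msupp δ) ⊆ O' →
        ∀ h : Euc d → ℝ, HarmOn h O' → ∫ x, h x ∂δ = ∫ x, h x ∂ω) := by
  rcases Nat.eq_zero_or_pos d with rfl | hd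
  · have hall : ∀ (h : Euc 0 → ℝ) (U : Set (Euc 0)), HarmOn h U := fun h U => by
      refine ⟨continuous_of_const (fun x y => by rw [Subsingleton.elim x y]) |>.continuousOn,
        fun x r hr _ => ?_⟩
      rw [eq_setAverage_iff_unit h x hr]
      have : ∀ z, h z = h x := fun z => by rw [Subsingleton.elim z x]
      simp [this]
    exact ⟨fun h V _ _ _ => hbal h (hall h O), fun O' _ _ h _ => hbal h (hall h O)⟩
  · set S := msupp ω ∪ msupp δ
    have hS : IsCompact S := hω.1.union hδ.1
    have hSO : S ⊆ O := union_subset hω.2.1 hδ.2.1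
    have hδS : ∀ᵐ x ∂δ, x ∈ S :=
      mem_of_superset (mem_ae_iff.2 hδ.2.2.1) fun _ => Or.inr
    have hωS : ∀ᵐ x ∂ω, x ∈ S :=
      mem_of_superset (mem_ae_iff.2 hω.2.2.1) fun _ => Or.inl
    have : IsFiniteMeasure δ := ⟨hδ.2.2.2⟩
    have : IsFiniteMeasure ω := ⟨hω.2.2.2⟩
    have key : ∀ h : Euc d → ℝ, ∀ V : Set (Euc d), IsOpen V → infill O S ⊆ V → HarmOn h V →
        ∫ x, h x ∂δ = ∫ x, h x ∂ω := fun h V hV hSV hh =>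
      integral_eq_of_eqPot hd hS (isCompact_infill hO hS) subset_union_left hV hSV hδS hωS
        (fun y hy => eqPot_of_notMem_infill hO hS hSO
          (Measure.restrict_eq_self_of_ae_mem hδS) (Measure.restrict_eq_self_of_ae_mem hωS)
          hbal hy) hh
    exact ⟨key, fun O' hO' hSO' h hh => key h O' hO' hSO' hh⟩
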